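/- Let n ≥ 3, 1 < p < ∞, and let Ω ⊆ ℝⁿ be a bounded connected open set such that ℝⁿ∖Ω is uniformly p-fat with constants c₀ and r₀. Then there exist q with 1 < q < p and a constant C > 0, both depending only on n, p and c₀, such that for every Lipschitz function u : Ω → ℝ with compact support in Ω and every x ∈ Ω with δ(x) < r₀ one has the pointwise Hardy inequality |u(x)| ≤ C δ(x) (M_{4δ(x)}(|∇u|^q)(x))^{1/q}. -/

import Mathlib

open MeasureTheory Metric
open scoped NNReal ENNReal

/-- The variational `p`-capacity of the condenser `(K, U)`: the infimum of `∫_U |∇φ|^p`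
over Lipschitz functions `φ` with compact support contained in `U` with `φ ≥ 1` on `K`. -/
noncomputable def pCap (n : ℕ) (p : ℝ) (K U : Set (EuclideanSpace ℝ (Fin n))) : ℝ :=
  sInf { c : ℝ | ∃ φ : EuclideanSpace ℝ (Fin n) → ℝ, (∃ L : ℝ≥0, LipschitzWith L φ) ∧
    HasCompactSupport φ ∧ tsupport φ ⊆ U ∧ (∀ x ∈ K, 1 ≤ φ x) ∧
    c = ∫ x in U, ‖fderiv ℝ φ x‖ ^ p }

/-- A closed set `E ⊆ ℝⁿ` is uniformly `p`-fat with constants `c₀, r₀ > 0` if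
`cap_p(E ∩ B̄(x,r), B(x,2r)) ≥ c₀ · cap_p(B̄(x,r), B(x,2r))` for all `x ∈ ∂E`, `0 < r ≤ r₀`. -/
def UniformlyFat (n : ℕ) (p c₀ r₀ : ℝ) (E : Set (EuclideanSpace ℝ (Fin n))) : Prop :=
  ∀ x ∈ frontier E, ∀ r : ℝ, 0 < r → r ≤ r₀ →
    c₀ * pCap n p (closedBall x r) (ball x (2 * r)) ≤
      pCap n p (E ∩ closedBall x r) (ball x (2 * r))

/-- The truncated centered Hardy–Littlewood maximal function
`M_R f(x) = sup_{0<r≤R} ⨍_{B(x,r)} |f|`. -/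
noncomputable def maxFn (n : ℕ) (R : ℝ) (f : EuclideanSpace ℝ (Fin n) → ℝ)
    (x : EuclideanSpace ℝ (Fin n)) : ℝ :=
  ⨆ r ∈ Set.Ioc (0 : ℝ) R, ⨍ y in ball x r, |f y|

section
variable {E : Type*} [NormedAddCommGroup E] [NormedSpace ℝ E] [FiniteDimensional ℝ E]
  [MeasurableSpace E] [BorelSpace E] (μ : Measure E) [μ.IsAddHaarMeasure]

theorem lintegral_comp_homothety {f : E → ℝ≥0∞} (hf : Measurable f) (x : E) {t : ℝ} (ht : 0 < t) :
    ∫⁻ z, f (x + t • (z - x)) ∂μ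
      = ENNReal.ofReal ((t ^ Module.finrank ℝ E)⁻¹) * ∫⁻ y, f y ∂μ := by
  have h1 := lintegral_sub_right_eq_self (μ := μ) (fun z => f (x + t • z)) x
  have h2 : ∫⁻ z, f (x + t • z) ∂μ = ∫⁻ y, f (x + y) ∂(Measure.map (t • ·) μ) := by
    rw [lintegral_map (by fun_prop) (by fun_prop)]
  rw [h1, h2, Measure.map_addHaar_smul μ ht.ne', lintegral_smul_measure,
    lintegral_add_left_eq_self, abs_of_pos (by positivity), smul_eq_mul]

theorem setLIntegral_comp_homothety_le {f : E → ℝ≥0∞} (hf : Measurable f) (x : E) {t : ℝ}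
    (ht : 0 < t) {A A' : Set E} (hA : MeasurableSet A) (hA' : MeasurableSet A')
    (h : ∀ z ∈ A, x + t • (z - x) ∈ A') :
    ∫⁻ z in A, f (x + t • (z - x)) ∂μ
      ≤ ENNReal.ofReal ((t ^ Module.finrank ℝ E)⁻¹) * ∫⁻ y in A', f y ∂μ := by
  rw [← lintegral_indicator hA', ← lintegral_comp_homothety μ (hf.indicator hA') x ht,
    ← lintegral_indicator hA]
  refine lintegral_mono fun z => ?_
  by_cases hz : z ∈ A
  · simp [hz, h z hz]
  · simp [hz]

theorem LipschitzWith.ae_enorm_sub_le_lintegral_fderiv {u : E → ℝ} {L : ℝ≥0}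
    (hu : LipschitzWith L u) (x : E) :
    ∀ᵐ z ∂μ, ‖u z - u x‖ₑ ≤
      ‖z - x‖ₑ * ∫⁻ t in Set.Ioo (0 : ℝ) 1, ‖fderiv ℝ u (x + t • (z - x))‖ₑ := by
  have hN := hu.ae_differentiableAt (μ := μ)
  have hmeas : MeasurableSet {y | ¬ DifferentiableAt ℝ u y} :=
    (measurableSet_of_differentiableAt ℝ u).compl
  have h1 : ∀ᵐ t ∂(volume.restrict (Set.Ioo (0 : ℝ) 1)), ∀ᵐ z ∂μ,
      DifferentiableAt ℝ u (x + t • (z - x)) := by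
    filter_upwards [ae_restrict_mem measurableSet_Ioo] with t ht
    rw [ae_iff]
    have := lintegral_comp_homothety μ (f := Set.indicator {y | ¬ DifferentiableAt ℝ u y} 1)
      (measurable_one.indicator hmeas) x ht.1
    rw [lintegral_indicator_one hmeas, ae_iff.1 hN, mul_zero] at this
    have e : ∀ z, ({y | ¬ DifferentiableAt ℝ u y}.indicator 1 (x + t • (z - x)) : ℝ≥0∞) =
      {z | ¬ DifferentiableAt ℝ u (x + t • (z - x))}.indicator 1 z := fun z => by
        simp [Set.indicator]
    simp_rw [e] at this
    rwa [lintegral_indicator_one] at this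
    exact hmeas.preimage (by fun_prop : Measurable fun z => x + t • (z - x))
  have h2 : ∀ᵐ z ∂μ, ∀ᵐ t ∂(volume.restrict (Set.Ioo (0 : ℝ) 1)),
      DifferentiableAt ℝ u (x + t • (z - x)) := by
    refine (Measure.ae_ae_comm ?_).1 h1
    exact (measurableSet_of_differentiableAt ℝ u).preimage
      (by fun_prop : Measurable fun q : ℝ × E => x + q.1 • (q.2 - x))
  filter_upwards [h2] with z hz
  set h : ℝ → ℝ := fun t => u (x + t • (z - x)) with hh
  have hlip : LipschitzWith (L * ‖z - x‖₊) h := by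
    refine hu.comp (LipschitzWith.of_dist_le_mul fun s t => ?_)
    rw [dist_add_left, dist_eq_norm, ← sub_smul, norm_smul, mul_comm, dist_eq_norm]
    rfl
  have hftc := (hlip.lipschitzOnWith (s := Set.uIcc 0 1)).absolutelyContinuousOnInterval
    |>.integral_deriv_eq_sub
  have e1 : h 1 - h 0 = u z - u x := by simp [hh]
  rw [← e1, ← hftc, intervalIntegral.integral_of_le zero_le_one, integral_Ioc_eq_integral_Ioo]
  refine (enorm_integral_le_lintegral_enorm _).trans ?_
  rw [← lintegral_const_mul' _ _ (by simp)]
  refine lintegral_mono_ae ?_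
  filter_upwards [hz] with t ht
  have hd : HasDerivAt h (fderiv ℝ u (x + t • (z - x)) (z - x)) t := by
    refine ht.hasFDerivAt.comp_hasDerivAt t ?_
    simpa using ((hasDerivAt_id t).smul_const (z - x)).const_add x
  rw [hd.deriv, mul_comm]
  exact ContinuousLinearMap.le_opENorm _ _

theorem measurable_enorm_fderiv (u : E → ℝ) : Measurable fun y => ‖fderiv ℝ u y‖ₑ :=
  (measurable_fderiv ℝ u).enorm

theorem LipschitzWith.setLIntegral_enorm_sub_le {u : E → ℝ} {L : ℝ≥0} (hu : LipschitzWith L u)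
    {x : E} {R : ℝ} {Λ : ℝ≥0∞}
    (hx : ∀ s, 0 < s → s ≤ R → ∫⁻ y in ball x s, ‖fderiv ℝ u y‖ₑ ∂μ ≤ Λ * μ (ball x s))
    {D : Set E} (hD : MeasurableSet D) (hDx : D ⊆ ball x R) :
    ∫⁻ z in D, ‖u z - u x‖ₑ ∂μ ≤ ENNReal.ofReal R * (Λ * μ (ball x R)) := by
  rcases D.eq_empty_or_nonempty with rfl | ⟨z₀, hz₀⟩
  · simp
  have hR : 0 < R := dist_nonneg.trans_lt (mem_ball.1 (hDx hz₀))
  have hm : Measurable fun q : E × ℝ => ‖fderiv ℝ u (x + q.2 • (q.1 - x))‖ₑ :=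
    (measurable_enorm_fderiv u).comp (by fun_prop)
  calc ∫⁻ z in D, ‖u z - u x‖ₑ ∂μ
      ≤ ∫⁻ z in D, (ENNReal.ofReal R *
          ∫⁻ t in Set.Ioo (0 : ℝ) 1, ‖fderiv ℝ u (x + t • (z - x))‖ₑ) ∂μ := by
        refine lintegral_mono_ae ?_
        filter_upwards [ae_restrict_of_ae (hu.ae_enorm_sub_le_lintegral_fderiv μ x),
          ae_restrict_mem hD] with z hz hzD
        refine hz.trans ?_
        gcongr
        rw [← ofReal_norm, ← dist_eq_norm]
        exact ENNReal.ofReal_le_ofReal (mem_ball.1 (hDx hzD)).le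
    _ = ENNReal.ofReal R * ∫⁻ t in Set.Ioo (0 : ℝ) 1, ∫⁻ z in D,
          ‖fderiv ℝ u (x + t • (z - x))‖ₑ ∂μ := by
        rw [lintegral_const_mul' _ _ ENNReal.ofReal_ne_top,
          lintegral_lintegral_swap hm.aemeasurable]
    _ ≤ ENNReal.ofReal R * ∫⁻ t in Set.Ioo (0 : ℝ) 1, Λ * μ (ball x R) := by
        gcongr 1
        refine lintegral_mono_ae ?_
        filter_upwards [ae_restrict_mem measurableSet_Ioo] with t ht
        have h1 := setLIntegral_comp_homothety_le μ (measurable_enorm_fderiv u) x ht.1 hD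
          (A' := ball x (t * R)) measurableSet_ball (fun z hz => by
            rw [mem_ball, dist_eq_norm, add_sub_cancel_left, norm_smul, Real.norm_of_nonneg ht.1.le,
              ← dist_eq_norm]
            exact mul_lt_mul_of_pos_left (mem_ball.1 (hDx hz)) ht.1)
        refine h1.trans ?_
        refine (mul_le_mul_right (hx (t * R) (mul_pos ht.1 hR)
          (mul_le_of_le_one_left hR.le ht.2.le)) _).trans_eq ?_
        rw [Measure.addHaar_ball_mul_of_pos μ x ht.1 R, Measure.addHaar_ball_center μ x R]
        have : ENNReal.ofReal ((t ^ Module.finrank ℝ E)⁻¹) *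
            ENNReal.ofReal (t ^ Module.finrank ℝ E) = 1 := by
          have := pow_pos ht.1 (Module.finrank ℝ E)
          rw [← ENNReal.ofReal_mul (by positivity), inv_mul_cancel₀ this.ne', ENNReal.ofReal_one]
        calc _ = (ENNReal.ofReal ((t ^ Module.finrank ℝ E)⁻¹) *
            ENNReal.ofReal (t ^ Module.finrank ℝ E)) * (Λ * μ (ball 0 R)) := by ring
          _ = _ := by rw [this, one_mul]
    _ = ENNReal.ofReal R * (Λ * μ (ball x R)) := by simp

theorem LipschitzWith.abs_sub_le_of_lintegral_fderiv_le {u : E → ℝ} {L : ℝ≥0}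
    (hu : LipschitzWith L u) {x y : E} {lam : ℝ} (hlam : 0 ≤ lam)
    (hx : ∀ s, 0 < s → s ≤ dist x y →
      ∫⁻ z in ball x s, ‖fderiv ℝ u z‖ₑ ∂μ ≤ ENNReal.ofReal lam * μ (ball x s))
    (hy : ∀ s, 0 < s → s ≤ dist x y →
      ∫⁻ z in ball y s, ‖fderiv ℝ u z‖ₑ ∂μ ≤ ENNReal.ofReal lam * μ (ball y s)) :
    |u x - u y| ≤ 2 ^ (Module.finrank ℝ E + 1) * lam * dist x y := by
  rcases eq_or_ne x y with rfl | hxy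
  · simp
  set R := dist x y with hR
  have hRpos : 0 < R := dist_pos.2 hxy
  set D := ball (midpoint ℝ x y) (2⁻¹ * R)
  have hDx : D ⊆ ball x R := ball_subset_ball' (by
    rw [dist_midpoint_left, Real.norm_of_nonneg (by norm_num), ← hR]; linarith)
  have hDy : D ⊆ ball y R := ball_subset_ball' (by
    rw [dist_midpoint_right, Real.norm_of_nonneg (by norm_num), ← hR]; linarith)
  have h1 := hu.setLIntegral_enorm_sub_le μ hx measurableSet_ball hDx
  have h2 := hu.setLIntegral_enorm_sub_le μ hy measurableSet_ball hDy
  have hμD : μ (ball x R) = ENNReal.ofReal (2 ^ Module.finrank ℝ E) * μ D := by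
    rw [Measure.addHaar_ball_mul_of_pos μ _ (by norm_num), ← mul_assoc,
      ← ENNReal.ofReal_mul (by positivity), ← mul_pow,
      Measure.addHaar_ball_center μ x R]
    norm_num
  have hμD' : μ (ball y R) = ENNReal.ofReal (2 ^ Module.finrank ℝ E) * μ D := by
    rw [← hμD, Measure.addHaar_ball_center μ y R, Measure.addHaar_ball_center μ x R]
  have hD0 : μ D ≠ 0 := (measure_ball_pos μ _ (by positivity)).ne'
  have hDt : μ D ≠ ⊤ := measure_ball_lt_top.ne
  have h3 : ‖u x - u y‖ₑ * μ D ≤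
      ENNReal.ofReal (2 ^ (Module.finrank ℝ E + 1) * lam * R) * μ D := by
    calc ‖u x - u y‖ₑ * μ D = ∫⁻ z in D, ‖u x - u y‖ₑ ∂μ := by simp
      _ ≤ ∫⁻ z in D, (‖u z - u x‖ₑ + ‖u z - u y‖ₑ) ∂μ := by
          refine lintegral_mono fun z => ?_
          rw [enorm_sub_rev (u z) (u x)]
          simpa using enorm_add_le (u x - u z) (u z - u y)
      _ = ∫⁻ z in D, ‖u z - u x‖ₑ ∂μ + ∫⁻ z in D, ‖u z - u y‖ₑ ∂μ := by
          refine lintegral_add_left ?_ _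
          exact (hu.continuous.sub continuous_const).measurable.enorm
      _ ≤ _ := add_le_add h1 h2
      _ = _ := by
          rw [hμD, hμD', pow_succ, ENNReal.ofReal_mul (by positivity),
            ENNReal.ofReal_mul (by positivity), ENNReal.ofReal_mul (by positivity)]
          rw [ENNReal.ofReal_ofNat]
          ring
  rw [ENNReal.mul_le_mul_iff_left hD0 hDt, ← ofReal_norm, Real.norm_eq_abs] at h3
  exact (ENNReal.ofReal_le_ofReal_iff (by positivity)).1 h3

theorem LipschitzWith.lintegral_lintegral_enorm_sub_rpow_le {u : E → ℝ} {L : ℝ≥0}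
    (hu : LipschitzWith L u) (w : E) (ρ : ℝ) {p : ℝ} (hp : 1 < p) :
    ∫⁻ y in ball w ρ, ∫⁻ z in ball w ρ, ‖u y - u z‖ₑ ^ p ∂μ ∂μ ≤
      ENNReal.ofReal (2 * ρ) ^ p * (2 ^ Module.finrank ℝ E * (μ (ball w ρ) *
        ∫⁻ y in ball w ρ, ‖fderiv ℝ u y‖ₑ ^ p ∂μ)) := by
  set B := ball w ρ with hB
  have hp0 : 0 < p := by linarith
  set g : E → ℝ≥0∞ := fun y => ‖fderiv ℝ u y‖ₑ ^ p with hg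
  have hgm : Measurable g := (measurable_enorm_fderiv u).pow_const p
  have hpoint : ∀ y ∈ B, ∀ᵐ z ∂(μ.restrict B), ‖u y - u z‖ₑ ^ p ≤
      ENNReal.ofReal (2 * ρ) ^ p * ∫⁻ t in Set.Ioo (0 : ℝ) 1, g (y + t • (z - y)) := by
    intro y hy
    filter_upwards [ae_restrict_of_ae (hu.ae_enorm_sub_le_lintegral_fderiv μ y),
      ae_restrict_mem measurableSet_ball] with z hz hzB
    have hmz : Measurable fun t : ℝ => ‖fderiv ℝ u (y + t • (z - y))‖ₑ :=
      (measurable_enorm_fderiv u).comp (by fun_prop)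
    have hJ : (∫⁻ t in Set.Ioo (0 : ℝ) 1, ‖fderiv ℝ u (y + t • (z - y))‖ₑ) ^ p ≤
        ∫⁻ t in Set.Ioo (0 : ℝ) 1, g (y + t • (z - y)) := by
      have := ENNReal.lintegral_mul_le_Lp_mul_Lq (volume.restrict (Set.Ioo (0 : ℝ) 1))
        (Real.HolderConjugate.conjExponent hp) hmz.aemeasurable
        (measurable_one (α := ℝ≥0∞)).aemeasurable
      simp only [mul_one, Pi.one_apply, ENNReal.one_rpow, lintegral_one,
        Measure.restrict_apply_univ,
        Real.volume_Ioo, sub_zero, ENNReal.ofReal_one] at this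
      calc _ ≤ ((∫⁻ t in Set.Ioo (0 : ℝ) 1, g (y + t • (z - y))) ^ (1 / p)) ^ p := by
            gcongr
        _ = _ := by rw [← ENNReal.rpow_mul, one_div_mul_cancel hp0.ne', ENNReal.rpow_one]
    rw [enorm_sub_rev]
    calc _ ≤ (ENNReal.ofReal (2 * ρ) *
          ∫⁻ t in Set.Ioo (0 : ℝ) 1, ‖fderiv ℝ u (y + t • (z - y))‖ₑ) ^ p := by
          refine ENNReal.rpow_le_rpow (hz.trans ?_) hp0.le
          gcongr
          rw [← ofReal_norm, ← dist_eq_norm]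
          refine ENNReal.ofReal_le_ofReal ?_
          have := dist_triangle_right z y w
          rw [mem_ball] at hzB hy
          linarith
      _ ≤ _ := by
          rw [ENNReal.mul_rpow_of_nonneg _ _ hp0.le]
          gcongr
  have hinner : ∀ t ∈ Set.Ioo (0 : ℝ) 1, ∫⁻ y in B, ∫⁻ z in B, g (y + t • (z - y)) ∂μ ∂μ ≤
      2 ^ Module.finrank ℝ E * (μ B * ∫⁻ y in B, g y ∂μ) := by
    intro t ht
    have hconv : ∀ y ∈ B, ∀ z ∈ B, ∀ s ∈ Set.Ioo (0 : ℝ) 1, y + s • (z - y) ∈ B :=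
      fun y hy z hz s hs => (convex_ball w ρ).add_smul_sub_mem hy hz ⟨hs.1.le, hs.2.le⟩
    have hhalf : ∀ s ∈ Set.Ioo (0 : ℝ) 1, 1 / 2 ≤ s → ∀ y ∈ B,
        ∫⁻ z in B, g (y + s • (z - y)) ∂μ ≤ 2 ^ Module.finrank ℝ E * ∫⁻ y in B, g y ∂μ := by
      intro s hs hs2 y hy
      refine (setLIntegral_comp_homothety_le μ hgm y hs.1 measurableSet_ball measurableSet_ball
        (fun z hz => hconv y hy z hz s hs)).trans ?_
      gcongr
      rw [← inv_pow, ← ENNReal.ofReal_ofNat 2, ← ENNReal.ofReal_pow (by norm_num)]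
      refine ENNReal.ofReal_le_ofReal ?_
      have := hs.1
      gcongr
      rw [inv_le_comm₀ hs.1 (by norm_num)]
      linarith
    have hfin : ∀ F : E → ℝ≥0∞, (∀ y ∈ B, F y ≤ 2 ^ Module.finrank ℝ E * ∫⁻ y in B, g y ∂μ) →
        ∫⁻ y in B, F y ∂μ ≤ 2 ^ Module.finrank ℝ E * (μ B * ∫⁻ y in B, g y ∂μ) := by
      intro F hF
      calc ∫⁻ y in B, F y ∂μ ≤ ∫⁻ y in B, 2 ^ Module.finrank ℝ E * ∫⁻ y in B, g y ∂μ ∂μ :=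
            setLIntegral_mono' measurableSet_ball hF
        _ = _ := by rw [setLIntegral_const]; ring
    rcases le_total (1 / 2) t with h | h
    · exact hfin _ (hhalf t ht h)
    · have hmt : Measurable fun q : E × E => g (q.1 + t • (q.2 - q.1)) := hgm.comp (by fun_prop)
      rw [lintegral_lintegral_swap hmt.aemeasurable]
      refine hfin _ fun z hz => ?_
      have := hhalf (1 - t) ⟨by linarith [ht.2], by linarith [ht.1]⟩ (by linarith) z hz
      refine le_trans (le_of_eq ?_) this
      refine lintegral_congr fun y => ?_
      congr 1
      module
  calc ∫⁻ y in B, ∫⁻ z in B, ‖u y - u z‖ₑ ^ p ∂μ ∂μ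
      ≤ ∫⁻ y in B, ∫⁻ z in B, (ENNReal.ofReal (2 * ρ) ^ p *
          ∫⁻ t in Set.Ioo (0 : ℝ) 1, g (y + t • (z - y))) ∂μ ∂μ :=
        setLIntegral_mono' measurableSet_ball fun y hy => lintegral_mono_ae (hpoint y hy)
    _ = ENNReal.ofReal (2 * ρ) ^ p * ∫⁻ y in B, ∫⁻ z in B,
          (∫⁻ t in Set.Ioo (0 : ℝ) 1, g (y + t • (z - y))) ∂μ ∂μ := by
        have ht : ENNReal.ofReal (2 * ρ) ^ p ≠ ⊤ :=
          ENNReal.rpow_ne_top_of_nonneg hp0.le ENNReal.ofReal_ne_top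
        simp_rw [lintegral_const_mul' _ _ ht]
    _ = ENNReal.ofReal (2 * ρ) ^ p * ∫⁻ t in Set.Ioo (0 : ℝ) 1, ∫⁻ y in B, ∫⁻ z in B,
          g (y + t • (z - y)) ∂μ ∂μ := by
        congr 1
        have : ∀ y, ∫⁻ z in B, (∫⁻ t in Set.Ioo (0 : ℝ) 1, g (y + t • (z - y))) ∂μ =
            ∫⁻ t in Set.Ioo (0 : ℝ) 1, ∫⁻ z in B, g (y + t • (z - y)) ∂μ := fun y =>
          lintegral_lintegral_swap
            (show Measurable fun q : E × ℝ => g (y + q.2 • (q.1 - y)) from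
              hgm.comp (by fun_prop)).aemeasurable
        simp_rw [this]
        refine lintegral_lintegral_swap ?_
        have : Measurable fun q : (E × ℝ) × E => g (q.1.1 + q.1.2 • (q.2 - q.1.1)) :=
          hgm.comp (by fun_prop)
        exact this.lintegral_prod_right'.aemeasurable
    _ ≤ ENNReal.ofReal (2 * ρ) ^ p * ∫⁻ t in Set.Ioo (0 : ℝ) 1,
          2 ^ Module.finrank ℝ E * (μ B * ∫⁻ y in B, g y ∂μ) := by
        gcongr 1
        exact setLIntegral_mono' measurableSet_Ioo hinner
    _ = _ := by simp

theorem LipschitzWith.ae_norm_fderiv_le_of_lipschitzOnWith {u : E → ℝ} {L K : ℝ≥0}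
    (hu : LipschitzWith L u) {G : Set E} (hG : MeasurableSet G) (hK : LipschitzOnWith K u G) :
    ∀ᵐ y ∂μ, y ∈ G → ‖fderiv ℝ u y‖ ≤ K := by
  rcases subsingleton_or_nontrivial E with hE | hE
  · refine .of_forall fun y _ => ?_
    have : fderiv ℝ u y = 0 := by
      ext v; rw [Subsingleton.elim v 0]; simp
    simp [this]
  obtain ⟨e, he⟩ := exists_norm_eq E zero_le_one
  set G' := G ∩ {y | DifferentiableAt ℝ u y}
  have hG' : MeasurableSet G' := hG.inter (measurableSet_of_differentiableAt ℝ u)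
  set T : ℝ →L[ℝ] E := ContinuousLinearMap.smulRight (1 : ℝ →L[ℝ] ℝ) e
  have hT : ∀ r, T r = r • e := fun r => by simp [T]
  have hap : ApproximatesLinearOn (fun y => T (u y)) (0 : E →L[ℝ] E) G' K := by
    intro y hy z hz
    simp only [zero_apply, sub_zero, ← map_sub]
    rw [hT, norm_smul, he, mul_one]
    simpa [dist_eq_norm] using hK.dist_le_mul y hy.1 z hz.1
  have h := hap.norm_fderiv_sub_le μ hG' (fun y => T.comp (fderiv ℝ u y)) fun y hy =>
    (T.hasFDerivAt.comp y hy.2.hasFDerivAt).hasFDerivWithinAt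
  rw [ae_restrict_iff' hG'] at h
  filter_upwards [h, hu.ae_differentiableAt (μ := μ)] with y hy hd hyG
  have h1 : ‖T.comp (fderiv ℝ u y)‖ ≤ K := by
    have := hy ⟨hyG, hd⟩
    rwa [sub_zero, ← NNReal.coe_le_coe, coe_nnnorm] at this
  refine ContinuousLinearMap.opNorm_le_bound _ K.coe_nonneg fun v => ?_
  have := (T.comp (fderiv ℝ u y)).le_of_opNorm_le h1 v
  rwa [ContinuousLinearMap.comp_apply, hT, norm_smul, he, mul_one] at this

theorem LipschitzWith.ae_fderiv_eq_of_eqOn {u v : E → ℝ} {L L' : ℝ≥0}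
    (hu : LipschitzWith L u) (hv : LipschitzWith L' v) {G : Set E} (hG : MeasurableSet G)
    (h : Set.EqOn u v G) : ∀ᵐ y ∂μ, y ∈ G → fderiv ℝ u y = fderiv ℝ v y := by
  have h0 : LipschitzOnWith 0 (fun y => u y - v y) G := by
    intro y hy z hz
    simp [h hy, h hz]
  filter_upwards [(hu.sub hv).ae_norm_fderiv_le_of_lipschitzOnWith μ hG h0,
    hu.ae_differentiableAt (μ := μ), hv.ae_differentiableAt (μ := μ)] with y hy h1 h2 hyG
  have := hy hyG
  rw [fderiv_fun_sub h1 h2] at this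
  simpa [sub_eq_zero] using this

theorem measure_le_of_forall_exists_ball_lintegral_gt {g : E → ℝ≥0∞} {H A : Set E} {R : ℝ}
    {Λ : ℝ≥0∞}
    (h : ∀ y ∈ H, ∃ s, 0 < s ∧ s ≤ R ∧ ball y s ⊆ A ∧ Λ * μ (ball y s) ≤ ∫⁻ z in ball y s, g z ∂μ) :
    Λ * μ H ≤ 5 ^ Module.finrank ℝ E * ∫⁻ z in A, g z ∂μ := by
  choose! r hr0 hrR hrA hr using h
  obtain ⟨t, htH, hdisj, hcov⟩ := Vitali.exists_disjoint_subfamily_covering_enlargement_closedBall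
    H (fun y => y) r R hrR 4 (by norm_num)
  have hdisj' : t.PairwiseDisjoint fun y => ball y (r y) :=
    hdisj.mono fun y => ball_subset_closedBall
  have hcount : t.Countable := hdisj'.countable_of_isOpen (fun _ _ => isOpen_ball)
    fun y hy => nonempty_ball.2 (hr0 y (htH hy))
  have hsub : H ⊆ ⋃ y ∈ t, ball y (5 * r y) := by
    intro y hy
    obtain ⟨b, hb, hyb⟩ := hcov y hy
    refine Set.mem_iUnion₂.2 ⟨b, hb, ?_⟩
    have := hyb (mem_closedBall_self (hr0 y hy).le)
    have h0 := hr0 b (htH hb)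
    exact closedBall_subset_ball (by linarith) this
  calc Λ * μ H ≤ Λ * ∑' y : t, μ (ball (y : E) (5 * r y)) := by
        gcongr
        exact (measure_mono hsub).trans (measure_biUnion_le μ hcount _)
    _ = ∑' y : t, 5 ^ Module.finrank ℝ E * (Λ * μ (ball (y : E) (r y))) := by
        rw [← ENNReal.tsum_mul_left]
        congr 1 with y
        rw [Measure.addHaar_ball_mul_of_pos μ _ (by norm_num), ← Measure.addHaar_ball_center μ y,
          ENNReal.ofReal_pow (by norm_num), ENNReal.ofReal_ofNat]
        ring
    _ ≤ ∑' y : t, 5 ^ Module.finrank ℝ E * ∫⁻ z in ball (y : E) (r y), g z ∂μ :=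
        ENNReal.tsum_le_tsum fun y => mul_le_mul_right (hr y (htH y.2)) _
    _ = 5 ^ Module.finrank ℝ E * ∫⁻ z in ⋃ y ∈ t, ball y (r y), g z ∂μ := by
        rw [ENNReal.tsum_mul_left, lintegral_biUnion hcount (fun _ _ => measurableSet_ball) hdisj']
    _ ≤ _ := by
        gcongr
        exact Set.iUnion₂_subset fun y hy => hrA y (htH hy)
end

section
variable {E : Type*} [PseudoMetricSpace E]

theorem exists_lipschitzWith_mul {η f : E → ℝ} {K L : ℝ≥0} {w : E} {ρ : ℝ}
    (hη : LipschitzWith K η) (hη1 : ∀ y, |η y| ≤ 1) (hη0 : ∀ y, ρ < dist y w → η y = 0)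
    (hf : LipschitzWith L f) : ∃ M : ℝ≥0, LipschitzWith M fun y => η y * f y := by
  set F : ℝ := |f w| + L * |ρ| with hF
  have hF0 : 0 ≤ F := by positivity
  have key : ∀ x y, dist x w ≤ ρ → |η x * f x - η y * f y| ≤ (K * F + L) * dist x y := by
    intro x y hx
    have h1 : |η x - η y| ≤ K * dist x y := by
      simpa [Real.dist_eq] using hη.dist_le_mul x y
    have h2 : |f x - f y| ≤ L * dist x y := by
      simpa [Real.dist_eq] using hf.dist_le_mul x y
    have h3 : |f x| ≤ F := by
      have := hf.dist_le_mul x w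
      rw [Real.dist_eq] at this
      have h4 : |f x| ≤ |f x - f w| + |f w| := by simpa using abs_add_le (f x - f w) (f w)
      have h5 : (L : ℝ) * dist x w ≤ L * |ρ| := by gcongr; exact hx.trans (le_abs_self _)
      linarith
    calc |η x * f x - η y * f y| = |(η x - η y) * f x + η y * (f x - f y)| := by ring_nf
      _ ≤ |η x - η y| * |f x| + |η y| * |f x - f y| := by
          rw [← abs_mul, ← abs_mul]; exact abs_add_le _ _
      _ ≤ (K * dist x y) * F + 1 * (L * dist x y) := by
          gcongr
          exact hη1 y
      _ = _ := by ring
  refine ⟨K * F.toNNReal + L, LipschitzWith.of_dist_le_mul fun x y => ?_⟩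
  rw [Real.dist_eq]
  push_cast
  rw [Real.coe_toNNReal _ hF0]
  rcases le_or_gt (dist x w) ρ with hx | hx
  · exact key x y hx
  rcases le_or_gt (dist y w) ρ with hy | hy
  · rw [abs_sub_comm, dist_comm]; exact key y x hy
  · rw [hη0 x hx, hη0 y hy]
    simp only [zero_mul, sub_self, abs_zero]
    positivity

/-- The piecewise linear cutoff: `1` on the ball of radius `r` and `0` off that of radius `3r/2`. -/
noncomputable def ballCutoff (w : E) (r : ℝ) (y : E) : ℝ := max 0 (min 1 (3 - 2 / r * dist y w))

theorem lipschitzWith_ballCutoff (w : E) {r : ℝ} (hr : 0 < r) :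
    LipschitzWith (2 / r).toNNReal (ballCutoff w r) := by
  refine (LipschitzWith.const_min (LipschitzWith.of_dist_le_mul fun x y => ?_) 1).const_max 0
  rw [Real.coe_toNNReal _ (by positivity), Real.dist_eq]
  have : (3 - 2 / r * dist x w) - (3 - 2 / r * dist y w) = 2 / r * (dist y w - dist x w) := by ring
  rw [this, abs_mul, abs_of_pos (by positivity), dist_comm x y]
  gcongr
  exact abs_dist_sub_le y x w

theorem ballCutoff_nonneg (w : E) (r : ℝ) (y : E) : 0 ≤ ballCutoff w r y := le_max_left _ _

theorem ballCutoff_le_one (w : E) (r : ℝ) (y : E) : ballCutoff w r y ≤ 1 :=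
  max_le zero_le_one (min_le_left _ _)

theorem ballCutoff_eq_one {w : E} {r : ℝ} (hr : 0 < r) {y : E} (hy : y ∈ closedBall w r) :
    ballCutoff w r y = 1 := by
  have : 2 / r * dist y w ≤ 2 / r * r := by gcongr; exact hy
  rw [div_mul_cancel₀ _ hr.ne'] at this
  rw [ballCutoff, min_eq_left (by linarith), max_eq_right zero_le_one]

theorem ballCutoff_eq_zero {w : E} {r : ℝ} (hr : 0 < r) {y : E} (hy : 3 / 2 * r < dist y w) :
    ballCutoff w r y = 0 := by
  have : 2 / r * (3 / 2 * r) ≤ 2 / r * dist y w := by gcongr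
  have e : 2 / r * (3 / 2 * r) = 3 := by field_simp
  exact max_eq_left ((min_le_right _ _).trans (by linarith))

theorem tsupport_subset_closedBall_of_dist {φ : E → ℝ} {w : E} {ρ : ℝ}
    (h : ∀ y, ρ < dist y w → φ y = 0) : tsupport φ ⊆ closedBall w ρ :=
  closure_minimal (fun y hy => not_lt.1 fun h' => hy (h y h')) isClosed_closedBall

end

section
variable {n : ℕ}

theorem LipschitzWith.integrableOn_norm_fderiv_rpow {u : EuclideanSpace ℝ (Fin n) → ℝ} {L : ℝ≥0}
    (hu : LipschitzWith L u) (w : EuclideanSpace ℝ (Fin n)) (ρ : ℝ) {p : ℝ} (hp : 0 ≤ p) :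
    IntegrableOn (fun y => ‖fderiv ℝ u y‖ ^ p) (ball w ρ) := by
  refine Measure.integrableOn_of_bounded (M := (L : ℝ) ^ p) measure_ball_lt_top.ne
    ((measurable_fderiv ℝ u).norm.pow_const p).aestronglyMeasurable (.of_forall fun y => ?_)
  rw [Real.norm_of_nonneg (by positivity)]
  exact Real.rpow_le_rpow (norm_nonneg _) (norm_fderiv_le_of_lipschitz ℝ hu) hp

theorem enorm_rpow_eq_ofReal {F : Type*} [NormedAddCommGroup F] (a : F) {p : ℝ} (hp : 0 ≤ p) :
    ‖a‖ₑ ^ p = ENNReal.ofReal (‖a‖ ^ p) := by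
  rw [← ofReal_norm, ENNReal.ofReal_rpow_of_nonneg (norm_nonneg _) hp]

theorem LipschitzWith.lintegral_enorm_fderiv_rpow {u : EuclideanSpace ℝ (Fin n) → ℝ} {L : ℝ≥0}
    (hu : LipschitzWith L u) (w : EuclideanSpace ℝ (Fin n)) (ρ : ℝ) {p : ℝ} (hp : 0 ≤ p) :
    ∫⁻ y in ball w ρ, ‖fderiv ℝ u y‖ₑ ^ p =
      ENNReal.ofReal (∫ y in ball w ρ, ‖fderiv ℝ u y‖ ^ p) := by
  rw [ofReal_integral_eq_lintegral_ofReal (hu.integrableOn_norm_fderiv_rpow w ρ hp)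
    (.of_forall fun _ => by positivity)]
  simp_rw [enorm_rpow_eq_ofReal _ hp]

theorem volume_ball_le_energy (hn : 1 ≤ n) {φ : EuclideanSpace ℝ (Fin n) → ℝ} {L : ℝ≥0}
    (hφ : LipschitzWith L φ) {w : EuclideanSpace ℝ (Fin n)} {r p : ℝ} (hr : 0 < r) (hp : 1 < p)
    (hsupp : tsupport φ ⊆ ball w (2 * r)) (h1 : ∀ y ∈ closedBall w r, 1 ≤ φ y) :
    volume (ball w r) ≤ ENNReal.ofReal ((8 * r) ^ p * 8 ^ n) *
      ∫⁻ y in ball w (2 * r), ‖fderiv ℝ φ y‖ₑ ^ p := by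
  have hp0 : 0 < p := by linarith
  have : Nonempty (Fin n) := ⟨⟨0, hn⟩⟩
  obtain ⟨e, he⟩ := exists_norm_eq (EuclideanSpace ℝ (Fin n)) (zero_le_one (α := ℝ))
  set B := ball w (4 * r)
  set A := ball (w + (3 * r) • e) r
  have hAB : A ⊆ B := ball_subset_ball' (by
    rw [dist_eq_norm, add_sub_cancel_left, norm_smul, he, Real.norm_of_nonneg (by positivity)]
    linarith)
  have hA0 : ∀ y ∈ A, φ y = 0 := by
    intro y hy
    refine image_eq_zero_of_notMem_tsupport fun h => ?_
    have h2 := mem_ball.1 (hsupp h)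
    have h3 := mem_ball.1 hy
    have h4 : dist (w + (3 * r) • e) w = 3 * r := by
      rw [dist_eq_norm, add_sub_cancel_left, norm_smul, he, Real.norm_of_nonneg (by positivity),
        mul_one]
    have := dist_triangle_left (w + (3 * r) • e) w y
    linarith
  have hvA : volume A = volume (ball w r) := by
    rw [Measure.addHaar_ball_center volume _ r, Measure.addHaar_ball_center volume w r]
  have hvB : volume B = 4 ^ n * volume (ball w r) := by
    rw [Measure.addHaar_ball_mul_of_pos volume _ (by norm_num),
      Measure.addHaar_ball_center volume w r, finrank_euclideanSpace_fin,
      ENNReal.ofReal_pow (by norm_num), ENNReal.ofReal_ofNat]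
  set I := ∫⁻ y in ball w (2 * r), ‖fderiv ℝ φ y‖ₑ ^ p
  have hI : ∫⁻ y in B, ‖fderiv ℝ φ y‖ₑ ^ p = I := by
    have hsub : ball w (2 * r) ⊆ B := ball_subset_ball (by linarith)
    have h0 : ∀ y, y ∉ ball w (2 * r) → ‖fderiv ℝ φ y‖ₑ ^ p = 0 := fun y hy => by
      have : fderiv ℝ φ y = 0 := fderiv_of_notMem_tsupport ℝ fun h => hy (hsupp h)
      rw [← ofReal_norm, this, norm_zero, ENNReal.ofReal_zero, ENNReal.zero_rpow_of_pos hp0]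
    change _ = ∫⁻ y in ball w (2 * r), ‖fderiv ℝ φ y‖ₑ ^ p
    rw [← lintegral_indicator measurableSet_ball, ← lintegral_indicator measurableSet_ball]
    refine lintegral_congr fun y => ?_
    by_cases hy : y ∈ ball w (2 * r)
    · rw [Set.indicator_of_mem hy, Set.indicator_of_mem (hsub hy)]
    · rw [Set.indicator_of_notMem hy, Set.indicator_apply_eq_zero]
      exact fun _ => h0 y hy
  have hP := hφ.lintegral_lintegral_enorm_sub_rpow_le volume w (4 * r) hp
  rw [finrank_euclideanSpace_fin, show 2 * (4 * r) = 8 * r by ring] at hP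
  change _ ≤ _ * (_ * (volume B * ∫⁻ y in B, ‖fderiv ℝ φ y‖ₑ ^ p)) at hP
  rw [hI, hvB] at hP
  have hlow : volume (ball w r) * volume (ball w r) ≤
      ∫⁻ y in B, ∫⁻ z in B, ‖φ y - φ z‖ₑ ^ p := by
    calc volume (ball w r) * volume (ball w r)
        = ∫⁻ y in ball w r, ∫⁻ z in A, 1 := by simp [hvA]
      _ ≤ ∫⁻ y in ball w r, ∫⁻ z in A, ‖φ y - φ z‖ₑ ^ p := by
          refine setLIntegral_mono' measurableSet_ball fun y hy => ?_
          refine setLIntegral_mono' measurableSet_ball fun z hz => ?_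
          rw [hA0 z hz, sub_zero, enorm_rpow_eq_ofReal _ hp0.le, ENNReal.one_le_ofReal]
          refine Real.one_le_rpow ?_ hp0.le
          exact (h1 y (ball_subset_closedBall hy)).trans (le_abs_self _)
      _ ≤ ∫⁻ y in ball w r, ∫⁻ z in B, ‖φ y - φ z‖ₑ ^ p := by
          gcongr
      _ ≤ _ := lintegral_mono_set (ball_subset_ball (by linarith))
  have h0 : volume (ball w r) ≠ 0 := (measure_ball_pos _ _ hr).ne'
  have ht : volume (ball w r) ≠ ⊤ := measure_ball_lt_top.ne
  refine (ENNReal.mul_le_mul_iff_left h0 ht).1 ((hlow.trans hP).trans_eq ?_)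
  have e8 : (8 : ℝ≥0∞) ^ n = 2 ^ n * 4 ^ n := by rw [← mul_pow]; norm_num
  rw [ENNReal.ofReal_mul (p := (8 * r) ^ p) (by positivity), ENNReal.ofReal_pow (by norm_num),
    ENNReal.ofReal_ofNat, ENNReal.ofReal_rpow_of_nonneg (by positivity) hp0.le, e8]
  ring

theorem volume_ball_le_pCap (hn : 1 ≤ n) (w : EuclideanSpace ℝ (Fin n)) {r p : ℝ} (hr : 0 < r)
    (hp : 1 < p) :
    volume.real (ball w r) ≤
      (8 * r) ^ p * 8 ^ n * pCap n p (closedBall w r) (ball w (2 * r)) := by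
  have hk : 0 < (8 * r) ^ p * 8 ^ n := by positivity
  rw [← div_le_iff₀' hk]
  refine le_csInf ?_ ?_
  · refine ⟨_, ballCutoff w r, ⟨_, lipschitzWith_ballCutoff w hr⟩, ?_, ?_,
      fun y hy => (ballCutoff_eq_one hr hy).ge, rfl⟩
    · exact HasCompactSupport.of_support_subset_isCompact (isCompact_closedBall w (3 / 2 * r))
        ((subset_tsupport _).trans
          (tsupport_subset_closedBall_of_dist fun y hy => ballCutoff_eq_zero hr hy))
    · exact (tsupport_subset_closedBall_of_dist fun y hy => ballCutoff_eq_zero hr hy).trans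
        (closedBall_subset_ball (by linarith))
  · rintro c ⟨φ, ⟨L, hL⟩, -, hsupp, h1, rfl⟩
    have := volume_ball_le_energy hn hL hr hp hsupp h1
    rw [hL.lintegral_enorm_fderiv_rpow w _ (by linarith), ← ENNReal.ofReal_mul hk.le] at this
    rw [div_le_iff₀' hk]
    refine ENNReal.toReal_le_of_le_ofReal (mul_nonneg hk.le ?_) this
    exact integral_nonneg fun _ => by positivity

theorem UniformlyFat.rpow_mul_volume_ball_le (hn : 1 ≤ n) {p c₀ r₀ : ℝ} (hp : 1 < p) (hc₀ : 0 < c₀)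
    {S : Set (EuclideanSpace ℝ (Fin n))} (hS : UniformlyFat n p c₀ r₀ S)
    {w : EuclideanSpace ℝ (Fin n)} (hw : w ∈ frontier S) {r : ℝ} (hr : 0 < r) (hr₀ : r ≤ r₀)
    {v : EuclideanSpace ℝ (Fin n) → ℝ} {L : ℝ≥0} (hv : LipschitzWith L v)
    (hv0 : ∀ y ∈ S, v y = 0) (a : ℝ) :
    ENNReal.ofReal (c₀ * |a| ^ p) * volume (ball w r) ≤
      ENNReal.ofReal ((8 * r) ^ p * 8 ^ n) * (2 ^ (p - 1) *
        ((∫⁻ y in ball w (2 * r), ‖fderiv ℝ v y‖ₑ ^ p) +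
          ENNReal.ofReal (2 / r) ^ p * ∫⁻ y in ball w (2 * r), ‖v y - a‖ₑ ^ p)) := by
  have hp0 : 0 < p := by linarith
  rcases eq_or_ne a 0 with rfl | ha
  · simp [hp0.ne']
  have hk : 0 < (8 * r) ^ p * 8 ^ n := by positivity
  have hηL := lipschitzWith_ballCutoff w hr
  have hfL : LipschitzWith (‖a⁻¹‖₊ * L) fun y => a⁻¹ * (a - v y) := by
    refine LipschitzWith.of_dist_le_mul fun y z => ?_
    have := hv.dist_le_mul y z
    rw [Real.dist_eq] at this ⊢
    rw [← mul_sub, abs_mul, sub_sub_sub_cancel_left, abs_sub_comm, NNReal.coe_mul, coe_nnnorm,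
      Real.norm_eq_abs, mul_assoc]
    gcongr
  set φ : EuclideanSpace ℝ (Fin n) → ℝ := fun y => ballCutoff w r y * (a⁻¹ * (a - v y)) with hφ
  obtain ⟨M, hM⟩ : ∃ M : ℝ≥0, LipschitzWith M φ := exists_lipschitzWith_mul hηL
    (fun y => by rw [abs_of_nonneg (ballCutoff_nonneg w r y)]; exact ballCutoff_le_one w r y)
    (fun y hy => ballCutoff_eq_zero hr hy) hfL
  have hφsupp : tsupport φ ⊆ closedBall w (3 / 2 * r) :=
    tsupport_subset_closedBall_of_dist fun y hy => by simp [hφ, ballCutoff_eq_zero hr hy]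
  have hcap : pCap n p (S ∩ closedBall w r) (ball w (2 * r)) ≤
      ∫ y in ball w (2 * r), ‖fderiv ℝ φ y‖ ^ p := by
    refine csInf_le ⟨0, ?_⟩ ⟨φ, ⟨M, hM⟩, ?_, ?_, ?_, rfl⟩
    · rintro c ⟨ψ, -, -, -, -, rfl⟩
      exact integral_nonneg fun _ => by positivity
    · exact HasCompactSupport.of_support_subset_isCompact (isCompact_closedBall w (3 / 2 * r))
        ((subset_tsupport _).trans hφsupp)
    · exact hφsupp.trans (closedBall_subset_ball (by linarith))
    · intro y hy
      simp [hφ, ballCutoff_eq_one hr hy.2, hv0 y hy.1, ha]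
  have h1 : c₀ * volume.real (ball w r) ≤
      (8 * r) ^ p * 8 ^ n * ∫ y in ball w (2 * r), ‖fderiv ℝ φ y‖ ^ p := by
    calc c₀ * volume.real (ball w r)
        ≤ c₀ * ((8 * r) ^ p * 8 ^ n * pCap n p (closedBall w r) (ball w (2 * r))) := by
          gcongr; exact volume_ball_le_pCap hn w hr hp
      _ = (8 * r) ^ p * 8 ^ n * (c₀ * pCap n p (closedBall w r) (ball w (2 * r))) := by ring
      _ ≤ _ := by
          gcongr
          exact (hS w hw r hr hr₀).trans hcap
  have h2 : ENNReal.ofReal c₀ * volume (ball w r) ≤ ENNReal.ofReal ((8 * r) ^ p * 8 ^ n) *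
      ∫⁻ y in ball w (2 * r), ‖fderiv ℝ φ y‖ₑ ^ p := by
    rw [hM.lintegral_enorm_fderiv_rpow w _ hp0.le, ← ENNReal.ofReal_mul hk.le,
      ← ofReal_measureReal measure_ball_lt_top.ne, ← ENNReal.ofReal_mul hc₀.le]
    exact ENNReal.ofReal_le_ofReal h1
  have h3 : ENNReal.ofReal (|a| ^ p) * ∫⁻ y in ball w (2 * r), ‖fderiv ℝ φ y‖ₑ ^ p ≤
      2 ^ (p - 1) *
        ((∫⁻ y in ball w (2 * r), ‖fderiv ℝ v y‖ₑ ^ p) +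
          ENNReal.ofReal (2 / r) ^ p * ∫⁻ y in ball w (2 * r), ‖v y - a‖ₑ ^ p) := by
    have ht : ENNReal.ofReal (2 / r) ^ p ≠ ⊤ :=
      ENNReal.rpow_ne_top_of_nonneg hp0.le ENNReal.ofReal_ne_top
    rw [← lintegral_const_mul' _ _ ENNReal.ofReal_ne_top, ← lintegral_const_mul' _ _ ht,
      ← lintegral_add_left ((measurable_enorm_fderiv v).pow_const p),
      ← lintegral_const_mul' _ _ (ENNReal.rpow_ne_top_of_nonneg (by linarith) (by simp))]
    refine lintegral_mono_ae (ae_restrict_of_ae ?_)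
    filter_upwards [hηL.ae_differentiableAt (μ := volume), hv.ae_differentiableAt (μ := volume)]
      with y hy1 hy2
    have hd : HasFDerivAt φ (ballCutoff w r y • (a⁻¹ • (-fderiv ℝ v y)) +
        (a⁻¹ * (a - v y)) • fderiv ℝ (ballCutoff w r) y) y :=
      hy1.hasFDerivAt.mul ((hy2.hasFDerivAt.const_sub a).const_mul a⁻¹)
    have hn1 : ‖fderiv ℝ φ y‖ ≤ |a|⁻¹ * (‖fderiv ℝ v y‖ + 2 / r * |v y - a|) := by
      rw [hd.fderiv]
      refine (norm_add_le _ _).trans ?_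
      rw [norm_smul, norm_smul, norm_smul, norm_neg, Real.norm_eq_abs, Real.norm_eq_abs,
        Real.norm_eq_abs, abs_mul, abs_of_nonneg (ballCutoff_nonneg w r y), abs_inv,
        abs_sub_comm a]
      have e1 : ‖fderiv ℝ (ballCutoff w r) y‖ ≤ 2 / r := by
        have := norm_fderiv_le_of_lipschitz ℝ hηL (x₀ := y)
        rwa [Real.coe_toNNReal _ (by positivity)] at this
      calc _ ≤ 1 * (|a|⁻¹ * ‖fderiv ℝ v y‖) + |a|⁻¹ * |v y - a| * (2 / r) := by
            gcongr
            exact ballCutoff_le_one w r y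
        _ = _ := by ring
    have hn2 : ‖fderiv ℝ φ y‖ₑ ≤ ENNReal.ofReal |a|⁻¹ *
        (‖fderiv ℝ v y‖ₑ + ENNReal.ofReal (2 / r) * ‖v y - a‖ₑ) := by
      rw [← ofReal_norm, ← ofReal_norm, ← ofReal_norm, ← ENNReal.ofReal_mul (by positivity),
        ← ENNReal.ofReal_add (by positivity) (by positivity), ← ENNReal.ofReal_mul (by positivity)]
      exact ENNReal.ofReal_le_ofReal hn1
    have ha' : ENNReal.ofReal (|a| ^ p) * ENNReal.ofReal |a|⁻¹ ^ p = 1 := by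
      have : 0 < |a| := abs_pos.2 ha
      rw [ENNReal.ofReal_rpow_of_nonneg (by positivity) hp0.le,
        ← ENNReal.ofReal_mul (by positivity),
        ← Real.mul_rpow (by positivity) (by positivity), mul_inv_cancel₀ this.ne', Real.one_rpow,
        ENNReal.ofReal_one]
    calc ENNReal.ofReal (|a| ^ p) * ‖fderiv ℝ φ y‖ₑ ^ p
        ≤ ENNReal.ofReal (|a| ^ p) * (ENNReal.ofReal |a|⁻¹ *
          (‖fderiv ℝ v y‖ₑ + ENNReal.ofReal (2 / r) * ‖v y - a‖ₑ)) ^ p := by gcongr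
      _ = (‖fderiv ℝ v y‖ₑ + ENNReal.ofReal (2 / r) * ‖v y - a‖ₑ) ^ p := by
          rw [ENNReal.mul_rpow_of_nonneg _ _ hp0.le, ← mul_assoc, ha', one_mul]
      _ ≤ 2 ^ (p - 1) * (‖fderiv ℝ v y‖ₑ ^ p + (ENNReal.ofReal (2 / r) * ‖v y - a‖ₑ) ^ p) :=
          ENNReal.rpow_add_le_mul_rpow_add_rpow _ _ hp.le
      _ = _ := by rw [ENNReal.mul_rpow_of_nonneg _ _ hp0.le]
  calc ENNReal.ofReal (c₀ * |a| ^ p) * volume (ball w r)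
      = ENNReal.ofReal (|a| ^ p) * (ENNReal.ofReal c₀ * volume (ball w r)) := by
        rw [ENNReal.ofReal_mul hc₀.le]; ring
    _ ≤ ENNReal.ofReal (|a| ^ p) * (ENNReal.ofReal ((8 * r) ^ p * 8 ^ n) *
          ∫⁻ y in ball w (2 * r), ‖fderiv ℝ φ y‖ₑ ^ p) := by gcongr
    _ = ENNReal.ofReal ((8 * r) ^ p * 8 ^ n) * (ENNReal.ofReal (|a| ^ p) *
          ∫⁻ y in ball w (2 * r), ‖fderiv ℝ φ y‖ₑ ^ p) := by ring
    _ ≤ _ := by gcongr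
end

section
variable {n : ℕ}

/-- The averages of `|∇u|^q` over the balls centred at `x` of radius at most `R` are at most
`t^q`. -/
def GradAverageLE (u : EuclideanSpace ℝ (Fin n) → ℝ) (q R t : ℝ)
    (x : EuclideanSpace ℝ (Fin n)) : Prop :=
  ∀ s, 0 < s → s ≤ R →
    ∫⁻ z in ball x s, ‖fderiv ℝ u z‖ₑ ^ q ≤ ENNReal.ofReal (t ^ q) * volume (ball x s)

variable {u : EuclideanSpace ℝ (Fin n) → ℝ} {q R t : ℝ} {x y : EuclideanSpace ℝ (Fin n)}

theorem GradAverageLE.mono {R' t' : ℝ} (h : GradAverageLE u q R t x) (hR : R' ≤ R) (ht : 0 ≤ t)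
    (htt : t ≤ t') (hq : 0 ≤ q) : GradAverageLE u q R' t' x := fun s hs hsR =>
  (h s hs (hsR.trans hR)).trans (by gcongr)

theorem isClosed_setOf_gradAverageLE (u : EuclideanSpace ℝ (Fin n) → ℝ) (q R t : ℝ) :
    IsClosed {x | GradAverageLE u q R t x} := by
  simp only [GradAverageLE, Set.ofPred_forall]
  refine isClosed_iInter fun s => isClosed_iInter fun _ => isClosed_iInter fun _ =>
    IsSeqClosed.isClosed fun a x ha hax => ?_
  set g : EuclideanSpace ℝ (Fin n) → ℝ≥0∞ := fun z => ‖fderiv ℝ u z‖ₑ ^ q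
  have hg : Measurable g := (measurable_enorm_fderiv u).pow_const q
  have ha' : ∀ m, ∫⁻ z, (ball (a m) s).indicator g z ≤
      ENNReal.ofReal (t ^ q) * volume (ball x s) := fun m => by
    rw [lintegral_indicator measurableSet_ball, Measure.addHaar_ball_center volume x,
      ← Measure.addHaar_ball_center volume (a m)]
    exact ha m
  change ∫⁻ z in ball x s, g z ≤ _
  calc ∫⁻ z in ball x s, g z = ∫⁻ z, (ball x s).indicator g z :=
        (lintegral_indicator measurableSet_ball _).symm
    _ ≤ ∫⁻ z, Filter.liminf (fun m => (ball (a m) s).indicator g z) Filter.atTop := by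
        refine lintegral_mono fun z => ?_
        by_cases hz : z ∈ ball x s
        · refine Filter.le_liminf_of_le (by isBoundedDefault) ?_
          filter_upwards [(tendsto_const_nhds.dist hax).eventually_lt_const (mem_ball.1 hz)]
            with m hm
          rw [Set.indicator_of_mem hz, Set.indicator_of_mem (mem_ball.2 hm)]
        · rw [Set.indicator_of_notMem hz]
          exact zero_le
    _ ≤ Filter.liminf (fun m => ∫⁻ z, (ball (a m) s).indicator g z) Filter.atTop :=
        lintegral_liminf_le fun m => hg.indicator measurableSet_ball
    _ ≤ _ := Filter.liminf_le_of_le (by isBoundedDefault) fun b hb => by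
        obtain ⟨m, hm⟩ := hb.exists
        exact hm.trans (ha' m)

theorem le_rpow_mul_rpow_add {q t a : ℝ} (hq : 1 ≤ q) (ht : 0 < t) (ha : 0 ≤ a) :
    a ≤ t ^ (1 - q) * a ^ q + t := by
  rcases le_or_gt a t with h | h
  · have : 0 ≤ t ^ (1 - q) * a ^ q := by positivity
    linarith
  · have ha0 : 0 < a := ht.trans h
    have h1 : a ^ (1 - q) ≤ t ^ (1 - q) :=
      Real.rpow_le_rpow_of_nonpos ht h.le (by linarith)
    calc a = a ^ (1 - q) * a ^ q := by
          rw [← Real.rpow_add ha0, sub_add_cancel, Real.rpow_one]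
      _ ≤ t ^ (1 - q) * a ^ q := by gcongr
      _ ≤ _ := by linarith

theorem GradAverageLE.lintegral_le (h : GradAverageLE u q R t x) (hq : 1 ≤ q) (ht : 0 < t) {s : ℝ}
    (hs : 0 < s) (hsR : s ≤ R) :
    ∫⁻ z in ball x s, ‖fderiv ℝ u z‖ₑ ≤ ENNReal.ofReal (2 * t) * volume (ball x s) := by
  calc ∫⁻ z in ball x s, ‖fderiv ℝ u z‖ₑ
      ≤ ∫⁻ z in ball x s, (ENNReal.ofReal (t ^ (1 - q)) * ‖fderiv ℝ u z‖ₑ ^ q +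
          ENNReal.ofReal t) := by
        refine lintegral_mono fun z => ?_
        rw [enorm_rpow_eq_ofReal _ (by linarith : 0 ≤ q), ← ofReal_norm,
          ← ENNReal.ofReal_mul (by positivity), ← ENNReal.ofReal_add (by positivity) ht.le]
        exact ENNReal.ofReal_le_ofReal (le_rpow_mul_rpow_add hq ht (norm_nonneg _))
    _ = ENNReal.ofReal (t ^ (1 - q)) * (∫⁻ z in ball x s, ‖fderiv ℝ u z‖ₑ ^ q) +
          ENNReal.ofReal t * volume (ball x s) := by
        rw [lintegral_add_right _ measurable_const, lintegral_const_mul' _ _ ENNReal.ofReal_ne_top,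
          setLIntegral_const]
    _ ≤ ENNReal.ofReal (t ^ (1 - q)) * (ENNReal.ofReal (t ^ q) * volume (ball x s)) +
          ENNReal.ofReal t * volume (ball x s) := by
        gcongr
        exact h s hs hsR
    _ = _ := by
        rw [← mul_assoc, ← ENNReal.ofReal_mul (by positivity), ← Real.rpow_add ht,
          sub_add_cancel, Real.rpow_one, ← add_mul, ← ENNReal.ofReal_add ht.le ht.le, two_mul]

theorem LipschitzWith.abs_sub_le_of_gradAverageLE {L : ℝ≥0} (hu : LipschitzWith L u) (hq : 1 ≤ q)
    (ht : 0 < t) (hx : GradAverageLE u q R t x) (hy : GradAverageLE u q R t y)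
    (hxy : dist x y ≤ R) : |u x - u y| ≤ 2 ^ (n + 2) * t * dist x y := by
  have := hu.abs_sub_le_of_lintegral_fderiv_le volume (lam := 2 * t) (by positivity)
    (fun s hs hs' => hx.lintegral_le hq ht hs (hs'.trans hxy))
    (fun s hs hs' => hy.lintegral_le hq ht hs (hs'.trans hxy))
  rw [finrank_euclideanSpace_fin] at this
  refine this.trans_eq ?_
  ring

theorem mul_volume_le_of_not_gradAverageLE {H A : Set (EuclideanSpace ℝ (Fin n))}
    (h : ∀ y ∈ H, ¬ GradAverageLE u q R t y) (hA : ∀ y ∈ H, ball y R ⊆ A) :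
    ENNReal.ofReal (t ^ q) * volume H ≤ 5 ^ n * ∫⁻ z in A, ‖fderiv ℝ u z‖ₑ ^ q := by
  have := measure_le_of_forall_exists_ball_lintegral_gt
    (volume : Measure (EuclideanSpace ℝ (Fin n)))
    (g := fun z => ‖fderiv ℝ u z‖ₑ ^ q) (H := H) (A := A) (R := R) (Λ := ENNReal.ofReal (t ^ q))
    fun y hy => ?_
  · rwa [finrank_euclideanSpace_fin] at this
  · have h1 := h y hy
    simp only [GradAverageLE, not_forall, not_le] at h1
    obtain ⟨s, hs, hsR, h2⟩ := h1
    exact ⟨s, hs, hsR, (ball_subset_ball hsR).trans (hA y hy), h2.le⟩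

theorem sum_rpow_le_two_rpow_mul_sum_rpow {b lam : ℕ → ℝ} {p : ℝ} (hp : 0 < p)
    (hlam : ∀ i, 0 ≤ lam i) (hlam2 : ∀ i, 2 * lam i ≤ lam (i + 1))
    (hb : ∀ i, b i = 0 ∨ b i = lam i) (k : ℕ) :
    (∑ i ∈ Finset.range k, b i) ^ p ≤ 2 ^ p * ∑ i ∈ Finset.range k, b i ^ p := by
  have hb0 : ∀ i, 0 ≤ b i := fun i => by
    rcases hb i with h | h
    · exact h.ge
    · exact h ▸ hlam i
  have hble : ∀ i, b i ≤ lam i := fun i => by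
    rcases hb i with h | h
    · exact h.trans_le (hlam i)
    · exact h.le
  have hsum : ∀ k, ∑ i ∈ Finset.range (k + 1), b i ≤ 2 * lam k := by
    intro k
    induction k with
    | zero => simpa using (hble 0).trans (by linarith [hlam 0])
    | succ k ih =>
      rw [Finset.sum_range_succ]
      linarith [hble (k + 1), hlam2 k]
  induction k with
  | zero => simp [hp.ne']
  | succ k ih =>
    have h0 : 0 ≤ ∑ i ∈ Finset.range k, b i ^ p :=
      Finset.sum_nonneg fun i _ => Real.rpow_nonneg (hb0 i) p
    rcases hb k with h | h
    · rw [Finset.sum_range_succ, Finset.sum_range_succ, h, add_zero,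
        Real.zero_rpow hp.ne', add_zero]
      exact ih
    · calc (∑ i ∈ Finset.range (k + 1), b i) ^ p ≤ (2 * lam k) ^ p :=
            Real.rpow_le_rpow (Finset.sum_nonneg fun i _ => hb0 i) (hsum k) hp.le
        _ = 2 ^ p * b k ^ p := by rw [h, Real.mul_rpow zero_le_two (hlam k)]
        _ ≤ _ := by
            rw [Finset.sum_range_succ]
            gcongr
            linarith

/-- Lipschitz truncation at one level. -/
theorem exists_lipschitzWith_eqOn_of_gradAverageLE {L : ℝ≥0} (hu : LipschitzWith L u) (hq : 1 ≤ q)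
    (ht : 0 < t) {G S : Set (EuclideanSpace ℝ (Fin n))} (hu0 : ∀ y ∈ S, u y = 0)
    (hG : ∀ y ∈ G, GradAverageLE u q R t y) (hGR : ∀ y ∈ G, ∀ z ∈ G, dist y z ≤ R)
    {c : ℝ} (hc : 0 ≤ c) (hGS : ∀ y ∈ G, |u y| ≤ c * t * infDist y S) :
    ∃ v : EuclideanSpace ℝ (Fin n) → ℝ,
      LipschitzWith ((2 ^ (n + 2) + c) * t).toNNReal v ∧ Set.EqOn u v G ∧ ∀ y ∈ S, v y = 0 := by
  have hGSd : ∀ y ∈ G, ∀ z ∈ S, |u y - u z| ≤ (2 ^ (n + 2) + c) * t * dist y z := by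
    intro y hy z hz
    rw [hu0 z hz, sub_zero]
    refine (hGS y hy).trans ?_
    have h1 : c ≤ 2 ^ (n + 2) + c := le_add_of_nonneg_left (by positivity)
    have h2 := infDist_le_dist_of_mem (x := y) hz
    have h3 : 0 ≤ infDist y S := infDist_nonneg
    gcongr
  have h : LipschitzOnWith ((2 ^ (n + 2) + c) * t).toNNReal u (G ∪ S) := by
    refine LipschitzOnWith.of_dist_le_mul fun y hy z hz => ?_
    rw [Real.coe_toNNReal _ (by positivity), Real.dist_eq]
    rcases hy with hy | hy <;> rcases hz with hz | hz
    · refine (hu.abs_sub_le_of_gradAverageLE hq ht (hG y hy) (hG z hz) (hGR y hy z hz)).trans ?_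
      gcongr
      exact le_add_of_nonneg_right hc
    · exact hGSd y hy z hz
    · rw [abs_sub_comm, dist_comm]
      exact hGSd z hz y hy
    · rw [hu0 y hy, hu0 z hz, sub_zero, abs_zero]
      positivity
  obtain ⟨v, hv, hv'⟩ := h.extend_real
  exact ⟨v, hv, hv'.mono Set.subset_union_left,
    fun y hy => (hv' (Set.mem_union_right _ hy)).symm.trans (hu0 y hy)⟩

end

section
variable {n : ℕ}

theorem LipschitzWith.sum_finset {α ι : Type*} [PseudoEMetricSpace α] {v : ι → α → ℝ} {K : ι → ℝ≥0}
    (hv : ∀ i, LipschitzWith (K i) (v i)) (s : Finset ι) :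
    LipschitzWith (∑ i ∈ s, K i) fun y => ∑ i ∈ s, v i y := by
  classical
  induction s using Finset.induction_on with
  | empty => simp
  | insert i s hi ih =>
    simp only [Finset.sum_insert hi]
    exact (hv i).add ih

theorem rpow_add_le_mul_rpow_add_rpow_of_nonneg {a b p : ℝ} (ha : 0 ≤ a) (hb : 0 ≤ b)
    (hp : 1 ≤ p) : (a + b) ^ p ≤ 2 ^ (p - 1) * (a ^ p + b ^ p) := by
  lift a to ℝ≥0 using ha
  lift b to ℝ≥0 using hb
  exact_mod_cast NNReal.rpow_add_le_mul_rpow_add_rpow a b hp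

theorem ae_norm_fderiv_average_le {u : EuclideanSpace ℝ (Fin n) → ℝ} {L : ℝ≥0}
    (hu : LipschitzWith L u) {v : ℕ → EuclideanSpace ℝ (Fin n) → ℝ} {K : ℕ → ℝ≥0}
    (hv : ∀ i, LipschitzWith (K i) (v i)) {G : ℕ → Set (EuclideanSpace ℝ (Fin n))}
    (hG : ∀ i, MeasurableSet (G i)) (hmono : Monotone G) (heq : ∀ i, Set.EqOn u (v i) (G i))
    (k : ℕ) :
    ∀ᵐ y, ‖fderiv ℝ (fun y => (k + 1 : ℝ)⁻¹ * ∑ i ∈ Finset.range (k + 1), v i y) y‖ ≤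
      (G k).indicator (fun y => ‖fderiv ℝ u y‖) y +
        (k + 1 : ℝ)⁻¹ * ∑ i ∈ Finset.range (k + 1), (G i)ᶜ.indicator (fun _ => (K i : ℝ)) y := by
  have h1 := ae_all_iff.2 fun i => (hv i).ae_differentiableAt (μ := volume)
  have h2 := ae_all_iff.2 fun i => hu.ae_fderiv_eq_of_eqOn volume (hv i) (hG i) (heq i)
  filter_upwards [h1, h2] with y hy1 hy2
  have hd : HasFDerivAt (fun y => (k + 1 : ℝ)⁻¹ * ∑ i ∈ Finset.range (k + 1), v i y)
      ((k + 1 : ℝ)⁻¹ • ∑ i ∈ Finset.range (k + 1), fderiv ℝ (v i) y) y :=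
    (HasFDerivAt.fun_sum fun i _ => (hy1 i).hasFDerivAt).const_mul _
  have hk : (0 : ℝ) < k + 1 := by positivity
  rw [hd.fderiv, norm_smul, Real.norm_of_nonneg (by positivity)]
  set X := (G k).indicator (fun y => ‖fderiv ℝ u y‖) y
  have hX : 0 ≤ X := Set.indicator_nonneg (fun _ _ => norm_nonneg _) _
  have key : ∀ i ∈ Finset.range (k + 1), ‖fderiv ℝ (v i) y‖ ≤
      X + (G i)ᶜ.indicator (fun _ => (K i : ℝ)) y := by
    intro i hi
    by_cases hy : y ∈ G i
    · have : y ∈ G k := hmono (Nat.lt_succ_iff.1 (Finset.mem_range.1 hi)) hy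
      rw [Set.indicator_of_notMem (Set.notMem_compl_iff.2 hy), add_zero, ← hy2 i hy]
      exact (Set.indicator_of_mem this fun y => ‖fderiv ℝ u y‖).ge
    · rw [Set.indicator_of_mem (Set.mem_compl hy)]
      have := norm_fderiv_le_of_lipschitz ℝ (hv i) (x₀ := y)
      linarith
  calc (k + 1 : ℝ)⁻¹ * ‖∑ i ∈ Finset.range (k + 1), fderiv ℝ (v i) y‖
      ≤ (k + 1 : ℝ)⁻¹ * ∑ i ∈ Finset.range (k + 1),
          (X + (G i)ᶜ.indicator (fun _ => (K i : ℝ)) y) := by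
        gcongr
        exact (norm_sum_le _ _).trans (Finset.sum_le_sum key)
    _ = _ := by
        rw [Finset.sum_add_distrib, Finset.sum_const, Finset.card_range, nsmul_eq_mul, mul_add]
        push_cast
        rw [inv_mul_cancel_left₀ hk.ne']

theorem lintegral_enorm_fderiv_rpow_le_of_truncation {u v : EuclideanSpace ℝ (Fin n) → ℝ}
    {p q a Λ : ℝ} (hp : 1 < p) (hq : 0 < q) (hqp : q ≤ p) (ha : 0 ≤ a)
    {lam : ℕ → ℝ} (hlam : ∀ i, 0 ≤ lam i) (hlam2 : ∀ i, 2 * lam i ≤ lam (i + 1))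
    {B : Set (EuclideanSpace ℝ (Fin n))}
    {G : ℕ → Set (EuclideanSpace ℝ (Fin n))} (hG : ∀ i, MeasurableSet (G i)) {k : ℕ}
    (hv : ∀ᵐ y, ‖fderiv ℝ v y‖ ≤ (G k).indicator (fun y => ‖fderiv ℝ u y‖) y +
      (k + 1 : ℝ)⁻¹ * ∑ i ∈ Finset.range (k + 1), (G i)ᶜ.indicator (fun _ => a * lam i) y)
    (hu : ∀ᵐ y, y ∈ G k → ‖fderiv ℝ u y‖ ≤ Λ) (hΛ : lam k ≤ Λ) {F : ℝ≥0∞}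
    (hF : ∫⁻ y in B, ‖fderiv ℝ u y‖ₑ ^ q ≤ F)
    (hFG : ∀ i, ENNReal.ofReal (lam i ^ q) * volume (B \ G i) ≤ F) :
    ∫⁻ y in B, ‖fderiv ℝ v y‖ₑ ^ p ≤ ENNReal.ofReal (2 ^ (p - 1) * Λ ^ (p - q)) *
      ((1 + ENNReal.ofReal ((2 * a / (k + 1)) ^ p * (k + 1))) * F) := by
  have hp0 : 0 < p := by linarith
  have hΛ0 : 0 ≤ Λ := (hlam k).trans hΛ
  have hmono : Monotone lam := monotone_nat_of_le_succ fun i => by linarith [hlam i, hlam2 i]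
  set b : ℕ → EuclideanSpace ℝ (Fin n) → ℝ := fun i => (G i)ᶜ.indicator fun _ => lam i with hb
  have hb0 : ∀ i y, 0 ≤ b i y := fun i y => Set.indicator_nonneg (fun _ _ => hlam i) _
  have hbm : ∀ i, Measurable (b i) := fun i => measurable_const.indicator (hG i).compl
  have hsplit : ∀ g, 0 ≤ g → g ≤ Λ → g ^ p ≤ Λ ^ (p - q) * g ^ q := by
    intro g hg hgΛ
    rcases hg.eq_or_lt with rfl | hg'
    · rw [Real.zero_rpow hp0.ne', Real.zero_rpow hq.ne', mul_zero]
    · calc g ^ p = g ^ (p - q) * g ^ q := by rw [← Real.rpow_add hg', sub_add_cancel]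
        _ ≤ _ := by gcongr
  have hpt : ∀ᵐ y, ‖fderiv ℝ v y‖ ^ p ≤ 2 ^ (p - 1) * Λ ^ (p - q) * (‖fderiv ℝ u y‖ ^ q +
      (2 * a / (k + 1)) ^ p * ∑ i ∈ Finset.range (k + 1), b i y ^ q) := by
    filter_upwards [hv, hu] with y hy1 hy2
    set X := (G k).indicator (fun y => ‖fderiv ℝ u y‖) y with hX
    have hX0 : 0 ≤ X := Set.indicator_nonneg (fun _ _ => norm_nonneg _) _
    have hXp : X ^ p ≤ Λ ^ (p - q) * ‖fderiv ℝ u y‖ ^ q := by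
      by_cases h : y ∈ G k
      · rw [hX, Set.indicator_of_mem h]
        exact hsplit _ (norm_nonneg _) (hy2 h)
      · rw [hX, Set.indicator_of_notMem h, Real.zero_rpow hp0.ne']
        positivity
    have hsum : ∑ i ∈ Finset.range (k + 1), (G i)ᶜ.indicator (fun _ => a * lam i) y =
        a * ∑ i ∈ Finset.range (k + 1), b i y := by
      rw [Finset.mul_sum]
      refine Finset.sum_congr rfl fun i _ => ?_
      by_cases h : y ∈ (G i)ᶜ
      · simp only [hb, Set.indicator_of_mem h]
      · simp only [hb, Set.indicator_of_notMem h, mul_zero]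
    have hs0 : 0 ≤ ∑ i ∈ Finset.range (k + 1), b i y := Finset.sum_nonneg fun i _ => hb0 i y
    rw [hsum, ← mul_assoc] at hy1
    have hbp : (∑ i ∈ Finset.range (k + 1), b i y) ^ p ≤
        2 ^ p * (Λ ^ (p - q) * ∑ i ∈ Finset.range (k + 1), b i y ^ q) := by
      refine (sum_rpow_le_two_rpow_mul_sum_rpow hp0 hlam hlam2 (fun i => ?_) _).trans ?_
      · by_cases h : y ∈ (G i)ᶜ
        · exact .inr (Set.indicator_of_mem h _)
        · exact .inl (Set.indicator_of_notMem h _)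
      · rw [Finset.mul_sum]
        rw [Finset.mul_sum, Finset.mul_sum]
        refine Finset.sum_le_sum fun i hi => ?_
        gcongr
        refine hsplit _ (hb0 i y) ((Set.indicator_le_self' (fun _ _ => hlam i) y).trans ?_)
        exact (hmono (Nat.lt_succ_iff.1 (Finset.mem_range.1 hi))).trans hΛ
    calc ‖fderiv ℝ v y‖ ^ p
        ≤ (X + (k + 1 : ℝ)⁻¹ * a * ∑ i ∈ Finset.range (k + 1), b i y) ^ p := by gcongr
      _ ≤ 2 ^ (p - 1) * (X ^ p + ((k + 1 : ℝ)⁻¹ * a * ∑ i ∈ Finset.range (k + 1), b i y) ^ p) :=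
          rpow_add_le_mul_rpow_add_rpow_of_nonneg hX0 (by positivity) hp.le
      _ = 2 ^ (p - 1) * (X ^ p +
            ((k + 1 : ℝ)⁻¹ * a) ^ p * (∑ i ∈ Finset.range (k + 1), b i y) ^ p) := by
          rw [Real.mul_rpow (x := (k + 1 : ℝ)⁻¹ * a) (by positivity) hs0]
      _ ≤ 2 ^ (p - 1) * (Λ ^ (p - q) * ‖fderiv ℝ u y‖ ^ q + ((k + 1 : ℝ)⁻¹ * a) ^ p *
            (2 ^ p * (Λ ^ (p - q) * ∑ i ∈ Finset.range (k + 1), b i y ^ q))) := by gcongr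
      _ = _ := by
          rw [show 2 * a / (k + 1 : ℝ) = 2 * ((k + 1 : ℝ)⁻¹ * a) by ring,
            Real.mul_rpow zero_le_two (by positivity)]
          ring
  have hbint : ∀ i, ∫⁻ y in B, ENNReal.ofReal (b i y ^ q) ≤ F := by
    intro i
    refine le_trans (le_of_eq ?_) (hFG i)
    rw [Set.sdiff_eq, ← setLIntegral_const, Set.inter_comm, ← setLIntegral_indicator (hG i).compl]
    refine lintegral_congr fun y => ?_
    by_cases h : y ∈ (G i)ᶜ
    · simp only [hb, Set.indicator_of_mem h]
    · simp only [hb, Set.indicator_of_notMem h, Real.zero_rpow hq.ne', ENNReal.ofReal_zero]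
  have hk : (0 : ℝ) < k + 1 := by positivity
  calc ∫⁻ y in B, ‖fderiv ℝ v y‖ₑ ^ p
      ≤ ∫⁻ y in B, ENNReal.ofReal (2 ^ (p - 1) * Λ ^ (p - q)) * (‖fderiv ℝ u y‖ₑ ^ q +
          ENNReal.ofReal ((2 * a / (k + 1)) ^ p) *
            ∑ i ∈ Finset.range (k + 1), ENNReal.ofReal (b i y ^ q)) := by
        refine lintegral_mono_ae (ae_restrict_of_ae ?_)
        filter_upwards [hpt] with y hy
        have hs0 : ∀ i ∈ Finset.range (k + 1), 0 ≤ b i y ^ q :=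
          fun i _ => Real.rpow_nonneg (hb0 i y) q
        rw [enorm_rpow_eq_ofReal _ hp0.le, enorm_rpow_eq_ofReal _ hq.le,
          ← ENNReal.ofReal_sum_of_nonneg hs0, ← ENNReal.ofReal_mul (by positivity),
          ← ENNReal.ofReal_add (by positivity)
            (mul_nonneg (by positivity) (Finset.sum_nonneg hs0)),
          ← ENNReal.ofReal_mul (by positivity)]
        exact ENNReal.ofReal_le_ofReal hy
    _ = ENNReal.ofReal (2 ^ (p - 1) * Λ ^ (p - q)) * ((∫⁻ y in B, ‖fderiv ℝ u y‖ₑ ^ q) +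
          ENNReal.ofReal ((2 * a / (k + 1)) ^ p) *
            ∑ i ∈ Finset.range (k + 1), ∫⁻ y in B, ENNReal.ofReal (b i y ^ q)) := by
        rw [lintegral_const_mul' _ _ ENNReal.ofReal_ne_top,
          lintegral_add_left ((measurable_enorm_fderiv u).pow_const q),
          lintegral_const_mul' _ _ ENNReal.ofReal_ne_top,
          lintegral_finsetSum _ fun i _ => ((hbm i).pow_const q).ennreal_ofReal]
    _ ≤ ENNReal.ofReal (2 ^ (p - 1) * Λ ^ (p - q)) * (F +
          ENNReal.ofReal ((2 * a / (k + 1)) ^ p) * ∑ i ∈ Finset.range (k + 1), F) := by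
        gcongr with i
        exact hbint i
    _ = _ := by
        rw [Finset.sum_const, Finset.card_range, nsmul_eq_mul,
          ENNReal.ofReal_mul (p := (2 * a / (k + 1)) ^ p) (by positivity), add_mul, one_mul,
          mul_assoc, ENNReal.ofReal_add (by positivity) zero_le_one,
          ENNReal.ofReal_natCast, ENNReal.ofReal_one]
        push_cast
        rfl

theorem UniformlyFat.exists_mem_rpow_le (hn : 1 ≤ n) {p c₀ r₀ : ℝ} (hp : 1 < p) (hc₀ : 0 < c₀)
    {S : Set (EuclideanSpace ℝ (Fin n))} (hS : UniformlyFat n p c₀ r₀ S)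
    {w : EuclideanSpace ℝ (Fin n)} (hw : w ∈ frontier S) {r : ℝ} (hr : 0 < r) (hr₀ : r ≤ r₀)
    {v : EuclideanSpace ℝ (Fin n) → ℝ} {L : ℝ≥0} (hv : LipschitzWith L v)
    (hv0 : ∀ y ∈ S, v y = 0) {G : Set (EuclideanSpace ℝ (Fin n))} (hGB : G ⊆ ball w (2 * r))
    (hvol : volume (ball w (2 * r)) ≤ 2 * volume G) {J : ℝ} (hJ : 0 ≤ J)
    (hI : ∫⁻ y in ball w (2 * r), ‖fderiv ℝ v y‖ₑ ^ p ≤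
      ENNReal.ofReal J * volume (ball w (2 * r))) :
    ∃ z ∈ G, c₀ * |v z| ^ p ≤
      16 ^ n * 2 ^ (p - 1) * (1 + 8 ^ p * 2 ^ (n + 1)) * ((8 * r) ^ p * J) := by
  have hp0 : 0 < p := by linarith
  set B := ball w (2 * r) with hB
  have hB0 : volume B ≠ 0 := (measure_ball_pos _ _ (by positivity)).ne'
  have hBt : volume B ≠ ⊤ := measure_ball_lt_top.ne
  have hG0 : volume G ≠ 0 := fun h => hB0 (by simpa [h] using hvol)
  have hGt : volume G ≠ ⊤ := measure_ne_top_of_subset hGB hBt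
  set I := ∫⁻ y in B, ‖fderiv ℝ v y‖ₑ ^ p
  set f : EuclideanSpace ℝ (Fin n) → ℝ≥0∞ := fun y => ∫⁻ z in B, ‖v y - v z‖ₑ ^ p with hf
  have hfm : Measurable f := by
    have hv' := hv.continuous
    refine Measurable.lintegral_prod_right' (f := fun a : _ × _ => ‖v a.1 - v a.2‖ₑ ^ p) ?_
    exact (by fun_prop : Continuous fun a : EuclideanSpace ℝ (Fin n) × EuclideanSpace ℝ (Fin n) =>
      v a.1 - v a.2).measurable.enorm.pow_const p
  obtain ⟨z, hz, hfz⟩ := exists_le_setLAverage hG0 hGt hfm.aemeasurable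
  refine ⟨z, hz, ?_⟩
  have hP := hv.lintegral_lintegral_enorm_sub_rpow_le volume w (2 * r) hp
  rw [finrank_euclideanSpace_fin] at hP
  have hfz1 : f z * volume G ≤ ∫⁻ y in B, f y := by
    rw [setLAverage_eq, ENNReal.le_div_iff_mul_le (.inl hG0) (.inl hGt)] at hfz
    exact hfz.trans (lintegral_mono_set hGB)
  have hfz2 : f z ≤ 2 ^ (n + 1) * ENNReal.ofReal (4 * r) ^ p * I := by
    refine (ENNReal.mul_le_mul_iff_left hB0 hBt).1 ?_
    calc f z * volume B ≤ f z * (2 * volume G) := by gcongr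
      _ = 2 * (f z * volume G) := by ring
      _ ≤ 2 * (ENNReal.ofReal (2 * (2 * r)) ^ p * (2 ^ n * (volume B * I))) := by
          exact mul_le_mul' le_rfl (hfz1.trans hP)
      _ = _ := by rw [show 2 * (2 * r) = 4 * r by ring]; ring
  have hcap := hS.rpow_mul_volume_ball_le hn hp hc₀ hw hr hr₀ hv hv0 (v z)
  have hfz3 : f z = ∫⁻ y in B, ‖v y - v z‖ₑ ^ p :=
    lintegral_congr fun y => by rw [enorm_sub_rev]
  rw [← hB, ← hfz3] at hcap
  have h0 : volume (ball w r) ≠ 0 := (measure_ball_pos _ _ hr).ne'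
  have ht : volume (ball w r) ≠ ⊤ := measure_ball_lt_top.ne
  have hvB : volume B = ENNReal.ofReal (2 ^ n) * volume (ball w r) := by
    rw [hB, Measure.addHaar_ball_mul_of_pos volume _ (by norm_num),
      Measure.addHaar_ball_center volume w r, finrank_euclideanSpace_fin]
  have e8 : ENNReal.ofReal (2 / r) ^ p * ENNReal.ofReal (4 * r) ^ p = ENNReal.ofReal (8 ^ p) := by
    rw [← ENNReal.mul_rpow_of_nonneg _ _ hp0.le, ← ENNReal.ofReal_mul (by positivity),
      ENNReal.ofReal_rpow_of_nonneg (by positivity) hp0.le]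
    congr 2
    field_simp
    norm_num
  have e2 : (2 : ℝ≥0∞) ^ (n + 1) = ENNReal.ofReal (2 ^ (n + 1)) := by
    rw [ENNReal.ofReal_pow (by norm_num), ENNReal.ofReal_ofNat]
  have e2p : (2 : ℝ≥0∞) ^ (p - 1) = ENNReal.ofReal (2 ^ (p - 1)) := by
    rw [← ENNReal.ofReal_rpow_of_pos (by norm_num), ENNReal.ofReal_ofNat]
  have hmain : ENNReal.ofReal (c₀ * |v z| ^ p) ≤ ENNReal.ofReal
      (16 ^ n * 2 ^ (p - 1) * (1 + 8 ^ p * 2 ^ (n + 1)) * ((8 * r) ^ p * J)) := by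
    refine (ENNReal.mul_le_mul_iff_left h0 ht).1 ?_
    calc ENNReal.ofReal (c₀ * |v z| ^ p) * volume (ball w r)
        ≤ ENNReal.ofReal ((8 * r) ^ p * 8 ^ n) * (2 ^ (p - 1) * (I + ENNReal.ofReal (2 / r) ^ p *
            (2 ^ (n + 1) * ENNReal.ofReal (4 * r) ^ p * I))) := hcap.trans (by gcongr)
      _ = ENNReal.ofReal ((8 * r) ^ p * 8 ^ n) * (2 ^ (p - 1) *
            (1 + (ENNReal.ofReal (2 / r) ^ p * ENNReal.ofReal (4 * r) ^ p) * 2 ^ (n + 1)) * I) := by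
          ring
      _ ≤ ENNReal.ofReal ((8 * r) ^ p * 8 ^ n) * (2 ^ (p - 1) *
            (1 + ENNReal.ofReal (8 ^ p) * 2 ^ (n + 1)) *
              (ENNReal.ofReal J * (ENNReal.ofReal (2 ^ n) * volume (ball w r)))) := by
          rw [e8, ← hvB]
          gcongr
      _ = (ENNReal.ofReal ((8 * r) ^ p * 8 ^ n) * (ENNReal.ofReal (2 ^ (p - 1)) *
            (ENNReal.ofReal 1 + ENNReal.ofReal (8 ^ p) * ENNReal.ofReal (2 ^ (n + 1))) *
              (ENNReal.ofReal J * ENNReal.ofReal (2 ^ n)))) * volume (ball w r) := by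
          rw [e2, e2p, ENNReal.ofReal_one]
          ring
      _ = _ := by
          rw [← ENNReal.ofReal_mul (by positivity), ← ENNReal.ofReal_mul hJ,
            ← ENNReal.ofReal_add (by positivity) (by positivity),
            ← ENNReal.ofReal_mul (by positivity), ← ENNReal.ofReal_mul (by positivity),
            ← ENNReal.ofReal_mul (by positivity), show (16 : ℝ) = 8 * 2 by norm_num, mul_pow]
          congr 2
          ring
  exact (ENNReal.ofReal_le_ofReal_iff (by positivity)).1 hmain

theorem UniformlyFat.hardy_absorption (hn : 1 ≤ n) {p q c₀ r₀ c : ℝ} (hp : 1 < p) (hc₀ : 0 < c₀)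
    (hq : 1 < q) (hqp : q ≤ p) (hc : 0 ≤ c) (k : ℕ)
    {S : Set (EuclideanSpace ℝ (Fin n))} (hS : UniformlyFat n p c₀ r₀ S)
    {w : EuclideanSpace ℝ (Fin n)} (hw : w ∈ frontier S) {r : ℝ} (hr : 0 < r) (hr₀ : r ≤ r₀)
    {u : EuclideanSpace ℝ (Fin n) → ℝ} {L : ℝ≥0} (hu : LipschitzWith L u)
    (hu0 : ∀ y ∈ S, u y = 0) {x : EuclideanSpace ℝ (Fin n)} (hxw : dist x w = 8 * r) {τ : ℝ}
    (hτ : 0 < τ) (hx : GradAverageLE u q (32 * r) τ x)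
    (hyp : ∀ y ∈ ball w (2 * r), ∀ t, τ ≤ t → GradAverageLE u q (16 * r) t y →
      |u y| ≤ c * t * infDist y S) :
    ∃ z ∈ ball w (2 * r), |u x - u z| ≤ 2 ^ (n + 2) * (2 * 80 ^ n * τ) * (10 * r) ∧
      c₀ * |u z| ^ p ≤ 16 ^ n * 2 ^ (p - 1) * (1 + 8 ^ p * 2 ^ (n + 1)) * ((8 * r) ^ p *
        (2 ^ (p - 1) * (2 ^ (n + 2) * ((2 * 80 ^ n) ^ (k + 1) * τ)) ^ (p - q) *
          ((1 + (2 * (2 ^ (n + 2) + c) / (k + 1)) ^ p * (k + 1)) * (80 ^ n * τ ^ q)))) := by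
  have hp0 : 0 < p := by linarith
  have hq0 : 0 < q := by linarith
  set M : ℝ := 2 * 80 ^ n with hM
  have hM2 : 2 ≤ M := by
    have : (1 : ℝ) ≤ 80 ^ n := one_le_pow₀ (by norm_num)
    linarith
  have hM1 : 1 ≤ M := by linarith
  set lam : ℕ → ℝ := fun i => M ^ (i + 1) * τ with hlam
  have hlam0 : ∀ i, 0 < lam i := fun i => by positivity
  have hlam2 : ∀ i, 2 * lam i ≤ lam (i + 1) := fun i => by
    calc 2 * lam i ≤ M * lam i := by
          have := (hlam0 i).le
          gcongr
      _ = lam (i + 1) := by simp only [hlam]; ring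
  have hmono : Monotone lam := monotone_nat_of_le_succ fun i => by linarith [hlam0 i, hlam2 i]
  have hτlam : ∀ i, τ ≤ lam i := fun i => le_mul_of_one_le_left hτ.le (one_le_pow₀ hM1)
  set B := ball w (2 * r) with hB
  set G : ℕ → Set (EuclideanSpace ℝ (Fin n)) :=
    fun i => B ∩ {y | GradAverageLE u q (16 * r) (lam i) y} with hG
  have hGm : ∀ i, MeasurableSet (G i) := fun i =>
    measurableSet_ball.inter (isClosed_setOf_gradAverageLE u q _ _).measurableSet
  have hGmono : Monotone G := fun i j hij =>
    Set.inter_subset_inter_right _ fun y hy => hy.mono le_rfl (hlam0 i).le (hmono hij) hq0.le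
  have hBB : ∀ y ∈ B, ∀ z ∈ B, dist y z ≤ 16 * r := fun y hy z hz => by
    have := dist_triangle_right y z w
    linarith [mem_ball.1 hy, mem_ball.1 hz]
  have hxB : ∀ y ∈ B, dist x y ≤ 10 * r := fun y hy => by
    have := dist_triangle_right x y w
    linarith [mem_ball.1 hy]
  have hBx : B ⊆ ball x (32 * r) := fun y hy => by
    rw [mem_ball']
    linarith [hxB y hy]
  have hvB : volume (ball x (32 * r)) = ENNReal.ofReal (16 ^ n) * volume B := by
    rw [hB, show 32 * r = 16 * (2 * r) by ring,
      Measure.addHaar_ball_mul_of_pos volume _ (by norm_num),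
      Measure.addHaar_ball_center volume w, finrank_euclideanSpace_fin]
  have hB0 : volume B ≠ 0 := (measure_ball_pos _ _ (by positivity)).ne'
  have hBt : volume B ≠ ⊤ := measure_ball_lt_top.ne
  have hxI : ∫⁻ z in ball x (32 * r), ‖fderiv ℝ u z‖ₑ ^ q ≤
      ENNReal.ofReal (16 ^ n * τ ^ q) * volume B := by
    refine (hx (32 * r) (by positivity) le_rfl).trans_eq ?_
    rw [hvB, ENNReal.ofReal_mul (by positivity)]
    ring
  set F : ℝ≥0∞ := ENNReal.ofReal (80 ^ n * τ ^ q) * volume B with hFdef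
  have hF : ∫⁻ y in B, ‖fderiv ℝ u y‖ₑ ^ q ≤ F := by
    refine (lintegral_mono_set hBx).trans (hxI.trans ?_)
    rw [hFdef]
    gcongr
    norm_num
  have hFG : ∀ i, ENNReal.ofReal (lam i ^ q) * volume (B \ G i) ≤ F := by
    intro i
    refine (mul_volume_le_of_not_gradAverageLE (A := ball x (32 * r)) (R := 16 * r)
      (fun y hy h => hy.2 ⟨hy.1, h⟩) fun y hy => ?_).trans ?_
    · refine ball_subset_ball' ?_
      rw [dist_comm]
      linarith [hxB y hy.1]
    · calc (5 : ℝ≥0∞) ^ n * ∫⁻ z in ball x (32 * r), ‖fderiv ℝ u z‖ₑ ^ q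
          ≤ ENNReal.ofReal (5 ^ n) * (ENNReal.ofReal (16 ^ n * τ ^ q) * volume B) := by
            rw [ENNReal.ofReal_pow (by norm_num), ENNReal.ofReal_ofNat]
            gcongr
        _ = F := by
            rw [← mul_assoc, ← ENNReal.ofReal_mul (by positivity), ← mul_assoc, ← mul_pow]
            norm_num [hFdef]
  have hvol : volume B ≤ 2 * volume (G 0) := by
    have h1 : 2 * volume (B \ G 0) ≤ volume B := by
      have hT : ENNReal.ofReal (80 ^ n * τ ^ q) ≠ 0 := by
        rw [Ne, ENNReal.ofReal_eq_zero, not_le]; positivity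
      refine (ENNReal.mul_le_mul_iff_right hT ENNReal.ofReal_ne_top).1 (le_trans ?_ (hFG 0))
      have e2 : ENNReal.ofReal (80 ^ n * τ ^ q) * 2 = ENNReal.ofReal (80 ^ n * τ ^ q * 2) := by
        rw [ENNReal.ofReal_mul (p := 80 ^ n * τ ^ q) (by positivity), ENNReal.ofReal_ofNat]
      rw [← mul_assoc, e2]
      gcongr
      calc 80 ^ n * τ ^ q * 2 = M ^ (1 : ℝ) * τ ^ q := by rw [Real.rpow_one, hM]; ring
        _ ≤ M ^ q * τ ^ q := by gcongr
        _ = lam 0 ^ q := by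
            simp only [hlam, zero_add, pow_one]
            rw [Real.mul_rpow (by positivity) hτ.le]
    have h2 : volume B ≤ volume (G 0) + volume (B \ G 0) := by
      refine (measure_mono fun y hy => ?_).trans (measure_union_le _ _)
      by_cases h : y ∈ G 0
      · exact .inl h
      · exact .inr ⟨hy, h⟩
    refine (ENNReal.add_le_add_iff_right hBt).1 ?_
    calc volume B + volume B ≤ 2 * (volume (G 0) + volume (B \ G 0)) := by
          rw [← two_mul]; gcongr
      _ = 2 * volume (G 0) + 2 * volume (B \ G 0) := mul_add _ _ _
      _ ≤ _ := by gcongr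
  have hex := fun i => exists_lipschitzWith_eqOn_of_gradAverageLE (S := S) hu hq.le (hlam0 i) hu0
    (fun y (hy : y ∈ G i) => hy.2) (fun y hy z hz => hBB y hy.1 z hz.1) hc
    fun y hy => hyp y hy.1 _ (hτlam i) hy.2
  choose v hvL hvG hvS using hex
  have hbound := ae_norm_fderiv_average_le hu hvL hGm hGmono hvG k
  set V : EuclideanSpace ℝ (Fin n) → ℝ :=
    fun y => (k + 1 : ℝ)⁻¹ * ∑ i ∈ Finset.range (k + 1), v i y with hV
  have hVL : ∃ K : ℝ≥0, LipschitzWith K V := by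
    refine ⟨_, LipschitzWith.of_dist_le_mul (K := ((k + 1 : ℝ)⁻¹).toNNReal *
      ∑ i ∈ Finset.range (k + 1), ((2 ^ (n + 2) + c) * lam i).toNNReal) fun y z => ?_⟩
    have := (LipschitzWith.sum_finset hvL (Finset.range (k + 1))).dist_le_mul y z
    rw [Real.dist_eq] at this ⊢
    rw [← mul_sub, abs_mul, abs_of_nonneg (by positivity), NNReal.coe_mul,
      Real.coe_toNNReal _ (by positivity), mul_assoc]
    gcongr
  obtain ⟨K, hVL⟩ := hVL
  have hVS : ∀ y ∈ S, V y = 0 := fun y hy => by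
    simp only [hV, Finset.sum_eq_zero fun i _ => hvS i y hy, mul_zero]
  have hVu : ∀ y ∈ G 0, V y = u y := fun y hy => by
    have : ∀ i ∈ Finset.range (k + 1), v i y = u y := fun i _ => (hvG i (hGmono i.zero_le hy)).symm
    simp only [hV, Finset.sum_congr rfl this, Finset.sum_const, Finset.card_range, nsmul_eq_mul]
    push_cast
    exact inv_mul_cancel_left₀ (by positivity) _
  have hA1 : (1 : ℝ) ≤ 2 ^ (n + 2) := one_le_pow₀ (by norm_num)
  have hgk : ∀ᵐ y, y ∈ G k → ‖fderiv ℝ u y‖ ≤ 2 ^ (n + 2) * lam k := by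
    have hlk : 0 ≤ 2 ^ (n + 2) * lam k := mul_nonneg (by positivity) (hlam0 k).le
    have := hu.ae_norm_fderiv_le_of_lipschitzOnWith volume (K := (2 ^ (n + 2) * lam k).toNNReal)
      (hGm k) (LipschitzOnWith.of_dist_le_mul fun y hy z hz => ?_)
    · rwa [Real.coe_toNNReal _ hlk] at this
    · rw [Real.coe_toNNReal _ hlk, Real.dist_eq]
      exact hu.abs_sub_le_of_gradAverageLE hq.le (hlam0 k) hy.2 hz.2 (hBB y hy.1 z hz.1)
  have hcoe : ∀ i, (((2 ^ (n + 2) + c) * lam i).toNNReal : ℝ) = (2 ^ (n + 2) + c) * lam i :=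
    fun i => Real.coe_toNNReal _ (mul_nonneg (by positivity) (hlam0 i).le)
  simp only [hcoe] at hbound
  have henergy := lintegral_enorm_fderiv_rpow_le_of_truncation (a := 2 ^ (n + 2) + c) hp hq0 hqp
    (by positivity) (fun i => (hlam0 i).le) hlam2 hGm hbound hgk
    (le_mul_of_one_le_left (hlam0 k).le hA1) hF hFG
  have hk : (0 : ℝ) < k + 1 := by positivity
  obtain ⟨z, hz, hz'⟩ := hS.exists_mem_rpow_le hn hp hc₀ hw hr hr₀ hVL hVS (G := G 0)
    Set.inter_subset_left hvol
    (J := 2 ^ (p - 1) * (2 ^ (n + 2) * (M ^ (k + 1) * τ)) ^ (p - q) *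
      ((1 + (2 * (2 ^ (n + 2) + c) / (k + 1)) ^ p * (k + 1)) * (80 ^ n * τ ^ q))) (by positivity)
    (henergy.trans_eq (by
      rw [hFdef, ← ENNReal.ofReal_one, ← ENNReal.ofReal_add (by positivity) (by positivity),
        ← mul_assoc, ← mul_assoc, ← ENNReal.ofReal_mul (by positivity),
        ← ENNReal.ofReal_mul (by positivity)]
      congr 2
      simp only [hlam]
      ring))
  rw [hVu z hz] at hz'
  refine ⟨z, hz.1, ?_, hz'⟩
  have hx' : GradAverageLE u q (16 * r) (lam 0) x :=
    hx.mono (by linarith) hτ.le (hτlam 0) hq0.le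
  have := hu.abs_sub_le_of_gradAverageLE hq.le (hlam0 0) hx' hz.2 (by linarith [hxB z hz.1])
  refine this.trans ?_
  simp only [hlam, zero_add, pow_one]
  gcongr
  exact hxB z hz.1

theorem add_rpow_le_rpow_add_of_nonneg {a b p : ℝ} (ha : 0 ≤ a) (hb : 0 ≤ b) (hp : 1 ≤ p) :
    a ^ p + b ^ p ≤ (a + b) ^ p := by
  lift a to ℝ≥0 using ha
  lift b to ℝ≥0 using hb
  exact_mod_cast NNReal.add_rpow_le_rpow_add a b hp

theorem exists_nat_mul_rpow_mul_le_one {p : ℝ} (hp : 1 < p) (Q : ℝ) :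
    ∃ k : ℕ, Q * ((4 / (k + 1 : ℝ)) ^ p * (k + 1)) ≤ 1 := by
  have h : Filter.Tendsto (fun k : ℕ => Q * (4 ^ p * ((k + 1 : ℕ) : ℝ) ^ (-(p - 1))))
      Filter.atTop (nhds (Q * (4 ^ p * 0))) :=
    (((tendsto_rpow_neg_atTop (by linarith : 0 < p - 1)).comp
      (tendsto_natCast_atTop_atTop.comp (Filter.tendsto_add_atTop_nat 1))).const_mul _).const_mul _
  rw [mul_zero, mul_zero] at h
  obtain ⟨k, hk⟩ := (h.eventually_lt_const one_pos).exists
  refine ⟨k, le_trans (le_of_eq ?_) hk.le⟩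
  have hk0 : (0 : ℝ) < k + 1 := by positivity
  push_cast
  rw [Real.div_rpow (by norm_num) hk0.le, neg_sub, Real.rpow_sub hk0, Real.rpow_one]
  ring

theorem exists_rpow_sub_le_two {p M : ℝ} (hp : 1 < p) (hM : 1 < M) (k : ℕ) :
    ∃ q, 1 < q ∧ q < p ∧ (M ^ (k + 1)) ^ (p - q) ≤ 2 := by
  have hM' : 1 < M ^ (k + 1) := one_lt_pow₀ hM (by simp)
  set s := min ((p - 1) / 2) (Real.logb (M ^ (k + 1)) 2) with hs
  have hs0 : 0 < s := lt_min (by linarith) (Real.logb_pos hM' (by norm_num))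
  have hs1 : s ≤ (p - 1) / 2 := min_le_left _ _
  refine ⟨p - s, by linarith, by linarith, ?_⟩
  rw [sub_sub_cancel]
  refine (Real.rpow_le_rpow_of_exponent_le hM'.le (min_le_right _ _)).trans_eq ?_
  exact Real.rpow_logb (by linarith) hM'.ne' (by norm_num)

theorem exists_uniformlyFat_hardy_improvement (hn : 1 ≤ n) {p c₀ : ℝ} (hp : 1 < p)
    (hc₀ : 0 < c₀) :
    ∃ q C : ℝ, 1 < q ∧ q < p ∧ 0 < C ∧ ∀ c, 0 ≤ c → ∀ (r₀ : ℝ)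
      (S : Set (EuclideanSpace ℝ (Fin n))), UniformlyFat n p c₀ r₀ S → ∀ w ∈ frontier S,
      ∀ r, 0 < r → r ≤ r₀ → ∀ (u : EuclideanSpace ℝ (Fin n) → ℝ) (L : ℝ≥0), LipschitzWith L u →
      (∀ y ∈ S, u y = 0) → ∀ x, dist x w = 8 * r → ∀ τ, 0 < τ → GradAverageLE u q (32 * r) τ x →
      (∀ y ∈ ball w (2 * r), ∀ t, τ ≤ t → GradAverageLE u q (16 * r) t y →
        |u y| ≤ c * t * infDist y S) →
      |u x| ≤ (C + c / 2) * τ * (8 * r) := by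
  have hp0 : 0 < p := by linarith
  set A : ℝ := 2 ^ (n + 2)
  have hA1 : 1 ≤ A := one_le_pow₀ (by norm_num)
  have hA0 : 0 < A := by positivity
  set M : ℝ := 2 * 80 ^ n with hM
  have hM1 : 1 < M := by
    have : (1 : ℝ) ≤ 80 ^ n := one_le_pow₀ (by norm_num)
    linarith
  set K : ℝ := 16 ^ n * 2 ^ (p - 1) * (1 + 8 ^ p * 2 ^ (n + 1))
  set Q : ℝ := K * (2 ^ (p - 1) * (A ^ p * 2) * 80 ^ n) / c₀ with hQ
  have hQ0 : 0 ≤ Q := by positivity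
  set P : ℝ := Q ^ (1 / p)
  have hP0 : 0 ≤ P := by positivity
  have hPQ : P ^ p = Q := by
    rw [← Real.rpow_mul hQ0, one_div_mul_cancel hp0.ne', Real.rpow_one]
  obtain ⟨k, hk⟩ := exists_nat_mul_rpow_mul_le_one hp Q
  obtain ⟨q, hq, hqp, hMq⟩ := exists_rpow_sub_le_two hp hM1 k
  refine ⟨q, 2 * A * M + P + A, hq, hqp, by positivity, ?_⟩
  intro c hc r₀ S hS w hw r hr hr₀ u L hu hu0 x hxw τ hτ hx hyp
  obtain ⟨z, hz, h1, h2⟩ := hS.hardy_absorption hn hp hc₀ hq hqp.le hc k hw hr hr₀ hu hu0 hxw hτ hx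
    hyp
  have hk0 : (0 : ℝ) < k + 1 := by positivity
  have hkQ : Q * ((2 * (A + c) / (k + 1)) ^ p * (k + 1)) ≤ ((A + c) / 2) ^ p := by
    rw [show 2 * (A + c) / (k + 1) = 4 / (k + 1) * ((A + c) / 2) by ring,
      Real.mul_rpow (by positivity) (by positivity)]
    calc Q * ((4 / (k + 1 : ℝ)) ^ p * ((A + c) / 2) ^ p * (k + 1))
        = Q * ((4 / (k + 1 : ℝ)) ^ p * (k + 1)) * ((A + c) / 2) ^ p := by ring
      _ ≤ 1 * ((A + c) / 2) ^ p := by gcongr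
      _ = _ := one_mul _
  have hΛ : (A * (M ^ (k + 1) * τ)) ^ (p - q) ≤ A ^ p * 2 * τ ^ (p - q) := by
    rw [Real.mul_rpow hA0.le (by positivity), Real.mul_rpow (by positivity) hτ.le, ← mul_assoc]
    have : A ^ (p - q) ≤ A ^ p := Real.rpow_le_rpow_of_exponent_le hA1 (by linarith)
    gcongr
  have hz1 : |u z| ^ p ≤ (8 * r * τ * (P + (A + c) / 2)) ^ p := by
    have hττ : τ ^ (p - q) * τ ^ q = τ ^ p := by rw [← Real.rpow_add hτ, sub_add_cancel]
    have h3 : c₀ * |u z| ^ p ≤ c₀ * ((8 * r) ^ p * τ ^ p *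
        (Q + Q * ((2 * (A + c) / (k + 1)) ^ p * (k + 1)))) := by
      refine h2.trans ?_
      calc K * ((8 * r) ^ p * (2 ^ (p - 1) * (A * (M ^ (k + 1) * τ)) ^ (p - q) *
            ((1 + (2 * (A + c) / (k + 1)) ^ p * (k + 1)) * (80 ^ n * τ ^ q))))
          ≤ K * ((8 * r) ^ p * (2 ^ (p - 1) * (A ^ p * 2 * τ ^ (p - q)) *
            ((1 + (2 * (A + c) / (k + 1)) ^ p * (k + 1)) * (80 ^ n * τ ^ q)))) := by gcongr
        _ = K * (2 ^ (p - 1) * (A ^ p * 2) * 80 ^ n) * ((8 * r) ^ p * (τ ^ (p - q) * τ ^ q) *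
            (1 + (2 * (A + c) / (k + 1)) ^ p * (k + 1))) := by ring
        _ = c₀ * Q * ((8 * r) ^ p * (τ ^ (p - q) * τ ^ q) *
            (1 + (2 * (A + c) / (k + 1)) ^ p * (k + 1))) := by
            rw [hQ, mul_div_cancel₀ _ hc₀.ne']
        _ = _ := by rw [hττ]; ring
    refine (le_of_mul_le_mul_left h3 hc₀).trans ?_
    rw [Real.mul_rpow (x := 8 * r * τ) (by positivity) (by positivity),
      Real.mul_rpow (x := 8 * r) (y := τ) (by positivity) hτ.le]
    gcongr
    calc Q + Q * ((2 * (A + c) / (k + 1)) ^ p * (k + 1)) ≤ P ^ p + ((A + c) / 2) ^ p := by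
          rw [hPQ]; gcongr
      _ ≤ _ := add_rpow_le_rpow_add_of_nonneg hP0 (by positivity) hp.le
  have hz2 : |u z| ≤ 8 * r * τ * (P + (A + c) / 2) :=
    (Real.rpow_le_rpow_iff (abs_nonneg _) (by positivity) hp0).1 hz1
  have h4 : |u x| ≤ |u x - u z| + |u z| := by simpa using abs_add_le (u x - u z) (u z)
  have h5 : 0 ≤ A * M * τ * r := by positivity
  have h6 : 0 ≤ A * τ * r := by positivity
  calc |u x| ≤ A * (M * τ) * (10 * r) + 8 * r * τ * (P + (A + c) / 2) := by linarith
    _ ≤ _ := by nlinarith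

theorem LipschitzWith.norm_fderiv_rpow_le {u : EuclideanSpace ℝ (Fin n) → ℝ} {L : ℝ≥0}
    (hu : LipschitzWith L u) {q : ℝ} (hq : 0 ≤ q) (y : EuclideanSpace ℝ (Fin n)) :
    ‖fderiv ℝ u y‖ ^ q ≤ (L : ℝ) ^ q :=
  Real.rpow_le_rpow (norm_nonneg _) (norm_fderiv_le_of_lipschitz ℝ hu) hq

theorem maxFn_nonneg (R : ℝ) (f : EuclideanSpace ℝ (Fin n) → ℝ) (x : EuclideanSpace ℝ (Fin n)) :
    0 ≤ maxFn n R f x := by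
  refine Real.iSup_nonneg fun r => Real.iSup_nonneg fun _ => ?_
  rw [setAverage_eq]
  exact smul_nonneg (by positivity) (integral_nonneg fun _ => abs_nonneg _)

theorem setAverage_abs_le_maxFn {f : EuclideanSpace ℝ (Fin n) → ℝ} {b : ℝ} (hf : ∀ y, |f y| ≤ b)
    {R s : ℝ} (hs : 0 < s) (hsR : s ≤ R) (x : EuclideanSpace ℝ (Fin n)) :
    ⨍ y in ball x s, |f y| ≤ maxFn n R f x := by
  have hb : 0 ≤ b := (abs_nonneg _).trans (hf x)
  have havg : ∀ r, ⨍ y in ball x r, |f y| ≤ b := fun r => by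
    rw [setAverage_eq, smul_eq_mul]
    have h1 : ∫ y in ball x r, |f y| ≤ b * volume.real (ball x r) :=
      (Real.le_norm_self _).trans (norm_setIntegral_le_of_norm_le_const (f := fun y => |f y|)
        measure_ball_lt_top fun y _ => by rw [Real.norm_eq_abs, abs_abs]; exact hf y)
    calc _ ≤ (volume.real (ball x r))⁻¹ * (b * volume.real (ball x r)) := by gcongr
      _ = (volume.real (ball x r))⁻¹ * volume.real (ball x r) * b := by ring
      _ ≤ 1 * b := by gcongr; exact inv_mul_le_one
      _ = b := one_mul b
  have hbdd : BddAbove (Set.range fun r => ⨆ _ : r ∈ Set.Ioc (0 : ℝ) R, ⨍ y in ball x r, |f y|) :=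
    ⟨b, by rintro _ ⟨r, rfl⟩; exact Real.iSup_le (fun _ => havg r) hb⟩
  refine le_ciSup_of_le hbdd s ?_
  rw [ciSup_pos ⟨hs, hsR⟩]

theorem LipschitzWith.gradAverageLE_of_maxFn {u : EuclideanSpace ℝ (Fin n) → ℝ} {L : ℝ≥0}
    (hu : LipschitzWith L u) {q R t : ℝ} (hq : 0 ≤ q) {x : EuclideanSpace ℝ (Fin n)}
    (h : maxFn n R (fun y => ‖fderiv ℝ u y‖ ^ q) x ≤ t ^ q) : GradAverageLE u q R t x := by
  intro s hs hsR
  have habs : ∀ y, |‖fderiv ℝ u y‖ ^ q| = ‖fderiv ℝ u y‖ ^ q := fun y =>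
    abs_of_nonneg (by positivity)
  have h1 := (setAverage_abs_le_maxFn (f := fun y => ‖fderiv ℝ u y‖ ^ q) (b := (L : ℝ) ^ q)
    (fun y => (habs y).trans_le (hu.norm_fderiv_rpow_le hq y)) hs hsR x).trans h
  simp only [habs] at h1
  have hv : 0 < volume.real (ball x s) :=
    ENNReal.toReal_pos (measure_ball_pos _ _ hs).ne' measure_ball_lt_top.ne
  rw [setAverage_eq, smul_eq_mul, inv_mul_le_iff₀ hv] at h1
  rw [hu.lintegral_enorm_fderiv_rpow x s hq, ← ofReal_measureReal measure_ball_lt_top.ne,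
    ← ENNReal.ofReal_mul' hv.le, mul_comm (t ^ q)]
  exact ENNReal.ofReal_le_ofReal h1

theorem infDist_frontier_le_infDist_compl {Ω : Set (EuclideanSpace ℝ (Fin n))}
    (hne : Ωᶜ.Nonempty)
    {y : EuclideanSpace ℝ (Fin n)} (hy : y ∈ Ω) : infDist y (frontier Ω) ≤ infDist y Ωᶜ := by
  have hΩu : Ω ≠ Set.univ := fun h => by simp [h] at hne
  obtain ⟨z, hz, hzd⟩ := exists_mem_frontier_infDist_compl_eq_dist hy hΩu
  rw [hzd]
  exact infDist_le_dist_of_mem hz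

end

theorem frontier_nonempty_of_isBounded {n : ℕ} (hn : 1 ≤ n) {Ω : Set (EuclideanSpace ℝ (Fin n))}
    (hb : Bornology.IsBounded Ω) (hne : Ω.Nonempty) : Ωᶜ.Nonempty ∧ (frontier Ω).Nonempty := by
  have : Nonempty (Fin n) := ⟨⟨0, hn⟩⟩
  have hu : Ω ≠ Set.univ := fun h =>
    NormedSpace.unbounded_univ ℝ (EuclideanSpace ℝ (Fin n)) (h ▸ hb)
  exact ⟨Set.nonempty_compl.2 hu, nonempty_frontier_iff.2 ⟨hne, hu⟩⟩

/-- **Pointwise Hardy inequality** (Theorem 3.4, Euclidean case): if `ℝⁿ∖Ω` is uniformly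
`p`-fat with constants `c₀, r₀`, then there are `1 < q < p` and `C > 0`, depending only on
`n`, `p`, `c₀`, such that `|u(x)| ≤ C δ(x) (M_{4δ(x)}(|∇u|^q)(x))^{1/q}` for all compactly
supported Lipschitz `u` on `Ω` and all `x ∈ Ω` with `δ(x) < r₀`. -/
theorem pointwise_hardy (n : ℕ) (hn : 3 ≤ n) (p c₀ : ℝ) (hp : 1 < p) (hc₀ : 0 < c₀) :
    ∃ q C : ℝ, 1 < q ∧ q < p ∧ 0 < C ∧
      ∀ (Ω : Set (EuclideanSpace ℝ (Fin n))) (r₀ : ℝ), 0 < r₀ →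
        Bornology.IsBounded Ω → IsConnected Ω → IsOpen Ω →
        UniformlyFat n p c₀ r₀ Ωᶜ →
        ∀ u : EuclideanSpace ℝ (Fin n) → ℝ, (∃ L : ℝ≥0, LipschitzWith L u) →
          HasCompactSupport u → tsupport u ⊆ Ω →
          ∀ x ∈ Ω, Metric.infDist x (frontier Ω) < r₀ →
            |u x| ≤ C * Metric.infDist x (frontier Ω) *
              (maxFn n (4 * Metric.infDist x (frontier Ω))
                (fun y => ‖fderiv ℝ u y‖ ^ q) x) ^ (1 / q) := by
  obtain ⟨q, C, hq, hqp, hC, H⟩ := exists_uniformlyFat_hardy_improvement (n := n) (by omega) hp hc₀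
  have hq0 : 0 < q := by linarith
  refine ⟨q, 2 * C, hq, hqp, by positivity, ?_⟩
  rintro Ω r₀ hr₀ hb hconn hopen hfat u ⟨L, hu⟩ - hsupp
  obtain ⟨hcne, hfne⟩ := frontier_nonempty_of_isBounded (by omega) hb hconn.nonempty
  have hu0 : ∀ y ∈ Ωᶜ, u y = 0 := fun y hy => image_eq_zero_of_notMem_tsupport fun h => hy (hsupp h)
  have hfc : ∀ w ∈ frontier Ω, w ∈ Ωᶜ := fun w hw hw' => hopen.inter_frontier_eq.subset ⟨hw', hw⟩
  have hproj : ∀ x ∈ Ω, ∃ w ∈ frontier Ω, infDist x (frontier Ω) = dist x w ∧ 0 < dist x w := by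
    intro x hx
    obtain ⟨w, hw, hd⟩ := isClosed_frontier.exists_infDist_eq_dist hfne x
    exact ⟨w, hw, hd, dist_pos.2 fun h => hfc w hw (h ▸ hx)⟩
  have hbound : ∀ ε : ℝ, 0 < ε → ∀ j : ℕ, ∀ x ∈ Ω, infDist x (frontier Ω) < r₀ → ∀ τ, ε ≤ τ →
      GradAverageLE u q (4 * infDist x (frontier Ω)) τ x →
      |u x| ≤ (2 * C + L / ε * (1 / 2) ^ j) * τ * infDist x (frontier Ω) := by
    intro ε hε j
    induction j with
    | zero =>
      intro x hx _ τ hτ _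
      obtain ⟨w, hw, hd, hd0⟩ := hproj x hx
      rw [hd]
      have h1 : |u x| ≤ L * dist x w := by
        simpa [hu0 w (hfc w hw), Real.dist_eq] using hu.dist_le_mul x w
      have h2 : (L : ℝ) ≤ L / ε * τ := by
        rw [div_mul_eq_mul_div, le_div_iff₀ hε]; gcongr
      have h3 : 0 ≤ 2 * C * τ := by have := hε.le.trans hτ; positivity
      refine h1.trans ?_
      gcongr
      linarith
    | succ j ih =>
      intro x hx hxr τ hτ hgrad
      obtain ⟨w, hw, hd, hd0⟩ := hproj x hx
      rw [hd] at hxr hgrad ⊢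
      have hτ0 : 0 < τ := hε.trans_le hτ
      have h8 : dist x w = 8 * (dist x w / 8) := by ring
      have key := H (2 * C + L / ε * (1 / 2) ^ j) (by positivity) r₀ Ωᶜ hfat w
        (by rwa [frontier_compl]) (dist x w / 8) (by positivity) (by linarith) u L hu hu0 x h8 τ hτ0
        (hgrad.mono (by linarith) hτ0.le le_rfl hq0.le) ?_
      · rw [← h8] at key
        refine key.trans (le_of_eq ?_)
        ring
      · intro y hy t ht hyg
        have ht0 : 0 < t := hτ0.trans_le ht
        by_cases hyΩ : y ∈ Ω
        · have hyd : infDist y (frontier Ω) < 2 * (dist x w / 8) :=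
            (infDist_le_dist_of_mem hw).trans_lt hy
          refine (ih y hyΩ (by linarith) t (hτ.trans ht)
            (hyg.mono (by linarith) ht0.le le_rfl hq0.le)).trans ?_
          gcongr
          exact infDist_frontier_le_infDist_compl hcne hyΩ
        · rw [hu0 y hyΩ, abs_zero]
          have := infDist_nonneg (x := y) (s := Ωᶜ)
          positivity
  intro x hx hxr
  set d := infDist x (frontier Ω) with hd
  set m := maxFn n (4 * d) (fun y => ‖fderiv ℝ u y‖ ^ q) x with hm
  have hm0 : 0 ≤ m := maxFn_nonneg _ _ _
  have hε : ∀ ε : ℝ, 0 < ε → |u x| ≤ 2 * C * (m ^ (1 / q) + ε) * d := by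
    intro ε hε
    have hg : GradAverageLE u q (4 * d) (m ^ (1 / q) + ε) x := by
      refine hu.gradAverageLE_of_maxFn hq0.le ?_
      calc m = (m ^ (1 / q)) ^ q := by
            rw [← Real.rpow_mul hm0, one_div_mul_cancel hq0.ne', Real.rpow_one]
        _ ≤ _ := Real.rpow_le_rpow (by positivity) (by linarith) hq0.le
    have hlim : Filter.Tendsto
        (fun j : ℕ => (2 * C + L / ε * (1 / 2) ^ j) * (m ^ (1 / q) + ε) * d) Filter.atTop
        (nhds ((2 * C + L / ε * 0) * (m ^ (1 / q) + ε) * d)) :=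
      (((tendsto_pow_atTop_nhds_zero_of_lt_one (by norm_num) (by norm_num)).const_mul
        _).const_add _).mul_const _ |>.mul_const _
    rw [mul_zero, add_zero] at hlim
    exact ge_of_tendsto' hlim fun j =>
      hbound ε hε j x hx hxr _ (by have : 0 ≤ m ^ (1 / q) := by positivity
                                   linarith) hg
  have hlim : Filter.Tendsto (fun ε : ℝ => 2 * C * (m ^ (1 / q) + ε) * d) (nhdsWithin 0 (Set.Ioi 0))
      (nhds (2 * C * (m ^ (1 / q) + 0) * d)) :=
    ((Continuous.tendsto (by fun_prop) 0).mono_left nhdsWithin_le_nhds)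
  have := ge_of_tendsto hlim (Filter.eventually_of_mem self_mem_nhdsWithin hε)
  refine this.trans (le_of_eq ?_)
  ring
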